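/- Let q ≥ 2 be a prime power, d ≥ 1, and let G be a finite simple graph on (d+1)(q−1)+1 vertices such that q > |N²(v)| + 2|N(v)| for every vertex v of G, where N(v) is the open neighborhood of v and N²(v) is the set of vertices at distance exactly two from v. Then for every continuous map f from the geometric simplex Δ_{V(G)} to ℝ^d there is a q-coloring C_1 ∪ C_2 ∪ … ∪ C_q = V(G) of G such that the intersection over i = 1,…,q of the images f(face spanned by C_i) is non-empty. -/

import Mathlib

/-! ### Chains on ordered tuples -/

namespace OrderedChain

section Chains

variable (K : Type*) [Field K] {X Y : Type*}

/-- Prepending a vertex to every tuple of a chain. -/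
noncomputable def cons (x : X) : (List X →₀ K) →ₗ[K] (List X →₀ K) :=
  Finsupp.lmapDomain K K (List.cons x)

/-- The boundary of a tuple, in the augmented complex of ordered tuples. -/
noncomputable def bdList : List X → (List X →₀ K)
  | [] => 0
  | x :: l => Finsupp.single l 1 - cons K x (bdList l)

/-- The augmented boundary operator; the empty tuple spans the degree of the augmentation. -/
noncomputable def bd : (List X →₀ K) →ₗ[K] (List X →₀ K) :=
  Finsupp.linearCombination K (bdList K)

/-- The chain map induced by a map of vertices. -/
noncomputable def push (f : X → Y) : (List X →₀ K) →ₗ[K] (List Y →₀ K) :=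
  Finsupp.lmapDomain K K (List.map f)

/-- The prism of a tuple between its images under `f` and `g`. -/
noncomputable def prismList (f g : X → Y) : List X → (List Y →₀ K)
  | [] => 0
  | x :: l => Finsupp.single (f x :: g x :: l.map g) 1 - cons K (f x) (prismList f g l)

/-- The prism operator, a chain homotopy from `push f` to `push g`. -/
noncomputable def prism (f g : X → Y) : (List X →₀ K) →ₗ[K] (List Y →₀ K) :=
  Finsupp.linearCombination K (prismList K f g)

/-- The chains supported on tuples of length `n` with property `P`. -/
def chains (P : List X → Prop) (n : ℕ) : Submodule K (List X →₀ K) :=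
  Finsupp.supported K K {l | l.length = n ∧ P l}

variable {K}

@[simp] theorem cons_single (x : X) (l : List X) (c : K) :
    cons K x (Finsupp.single l c) = Finsupp.single (x :: l) c := by
  simp [cons]

@[simp] theorem push_single (f : X → Y) (l : List X) (c : K) :
    push K f (Finsupp.single l c) = Finsupp.single (l.map f) c := by
  simp [push]

@[simp] theorem bd_single (l : List X) : bd K (Finsupp.single l 1) = bdList K l := by
  simp [bd]

@[simp] theorem prism_single (f g : X → Y) (l : List X) :
    prism K f g (Finsupp.single l 1) = prismList K f g l := by
  simp [prism]

theorem linearMap_ext_list {M : Type*} [AddCommGroup M] [Module K M]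
    {A B : (List X →₀ K) →ₗ[K] M}
    (h : ∀ l, A (Finsupp.single l 1) = B (Finsupp.single l 1)) : A = B :=
  Finsupp.lhom_ext' fun l => LinearMap.ext_ring (h l)

theorem bd_cons (x : X) (z : List X →₀ K) : bd K (cons K x z) = z - cons K x (bd K z) := by
  have : (bd K).comp (cons K x) = LinearMap.id - (cons K x).comp (bd K) :=
    linearMap_ext_list fun l => by simp [bdList]
  exact LinearMap.congr_fun this z

theorem bd_bd (z : List X →₀ K) : bd K (bd K z) = 0 := by
  have : (bd K).comp (bd K) = (0 : (List X →₀ K) →ₗ[K] (List X →₀ K)) :=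
    linearMap_ext_list fun l => by
      induction l with
      | nil => simp [bdList]
      | cons x l ih =>
        simp only [LinearMap.comp_apply, bd_single, bdList, map_sub, bd_cons] at ih ⊢
        simp [ih]
  exact LinearMap.congr_fun this z

theorem push_cons (f : X → Y) (x : X) (z : List X →₀ K) :
    push K f (cons K x z) = cons K (f x) (push K f z) := by
  have : (push K f).comp (cons K x) = (cons K (f x)).comp (push K f) :=
    linearMap_ext_list fun l => by simp
  exact LinearMap.congr_fun this z

theorem bd_push (f : X → Y) (z : List X →₀ K) : bd K (push K f z) = push K f (bd K z) := by
  have : (bd K).comp (push K f) = (push K f).comp (bd K) :=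
    linearMap_ext_list fun l => by
      induction l with
      | nil => simp [bdList]
      | cons x l ih =>
        simp only [LinearMap.comp_apply, bd_single, bdList, push_single, List.map_cons, map_sub,
          push_cons] at ih ⊢
        rw [ih]
  exact LinearMap.congr_fun this z

theorem prism_cons (f g : X → Y) (x : X) (z : List X →₀ K) :
    prism K f g (cons K x z) =
      cons K (f x) (cons K (g x) (push K g z)) - cons K (f x) (prism K f g z) := by
  have : (prism K f g).comp (cons K x) =
      (cons K (f x)).comp ((cons K (g x)).comp (push K g)) -
        (cons K (f x)).comp (prism K f g) :=
    linearMap_ext_list fun l => by simp [prismList]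
  exact LinearMap.congr_fun this z

theorem bd_prism (f g : X → Y) (z : List X →₀ K) :
    bd K (prism K f g z) = push K g z - push K f z - prism K f g (bd K z) := by
  have : (bd K).comp (prism K f g) = push K g - push K f - (prism K f g).comp (bd K) :=
    linearMap_ext_list fun l => by
      induction l with
      | nil => simp [bdList, prismList]
      | cons x l ih =>
        simp only [LinearMap.comp_apply, LinearMap.sub_apply, bd_single, bdList, push_single,
          prism_single, prismList, map_sub, bd_cons, List.map_cons] at ih ⊢
        rw [ih, prism_cons, ← bd_single (K := K) (l.map g), ← push_single g, bd_push, bd_single]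
        simp only [map_sub, push_single, cons_single]
        abel
  exact LinearMap.congr_fun this z

theorem map_mem_of_mem_chains {M : Type*} [AddCommGroup M] [Module K M]
    {P : List X → Prop} {n : ℕ} (A : (List X →₀ K) →ₗ[K] M) {N : Submodule K M}
    (h : ∀ l : List X, l.length = n → P l → A (Finsupp.single l 1) ∈ N)
    {z : List X →₀ K} (hz : z ∈ chains K P n) : A z ∈ N := by
  rw [chains, Finsupp.supported_eq_span_single] at hz
  refine Submodule.span_induction (p := fun z _ => A z ∈ N) ?_ (by simp)
    (fun x y _ _ hx hy => by rw [map_add]; exact N.add_mem hx hy)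
    (fun c x _ hx => by rw [map_smul]; exact N.smul_mem c hx) hz
  rintro _ ⟨l, ⟨hl, hP⟩, rfl⟩
  exact h l hl hP

theorem single_mem_chains {P : List X → Prop} {n : ℕ} {l : List X} (hl : l.length = n)
    (hP : P l) (c : K) : Finsupp.single l c ∈ chains K P n :=
  Finsupp.single_mem_supported K c ⟨hl, hP⟩

theorem chains_mono {P Q : List X → Prop} (h : ∀ l, P l → Q l) (n : ℕ) :
    chains K P n ≤ chains K Q n :=
  Finsupp.supported_mono fun _ hl => ⟨hl.1, h _ hl.2⟩

theorem cons_mem_chains {P Q : List X → Prop} {n : ℕ} {x : X} (h : ∀ l, P l → Q (x :: l))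
    {z : List X →₀ K} (hz : z ∈ chains K P n) : cons K x z ∈ chains K Q (n + 1) :=
  map_mem_of_mem_chains _ (fun l hl hP => by
    rw [cons_single]; exact single_mem_chains (by simp [hl]) (h l hP) 1) hz

theorem push_mem_chains {P : List X → Prop} {Q : List Y → Prop} {n : ℕ} {f : X → Y}
    (h : ∀ l, P l → Q (l.map f)) {z : List X →₀ K} (hz : z ∈ chains K P n) :
    push K f z ∈ chains K Q n :=
  map_mem_of_mem_chains _ (fun l hl hP => by
    rw [push_single]; exact single_mem_chains (by simp [hl]) (h l hP) 1) hz

theorem bdList_mem (l : List X) (n : ℕ) (hn : l.length = n + 1) :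
    bdList K l ∈ chains K (fun l' => l'.Sublist l) n := by
  induction l generalizing n with
  | nil => simp at hn
  | cons x l ih =>
    rw [bdList]
    refine Submodule.sub_mem _ (single_mem_chains (by simpa using hn) (by simp) 1) ?_
    cases n with
    | zero =>
      have : l = [] := by simpa using hn
      subst this
      simp [bdList]
    | succ m => exact cons_mem_chains (fun l' h => h.cons_cons x) (ih m (by simpa using hn))

theorem bd_mem_chains {P : List X → Prop} (hP : ∀ l l' : List X, l'.Sublist l → P l → P l')
    {n : ℕ} {z : List X →₀ K} (hz : z ∈ chains K P (n + 1)) : bd K z ∈ chains K P n :=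
  map_mem_of_mem_chains _ (fun l hl hl' => by
    rw [bd_single]
    exact chains_mono (fun l' h => hP l l' h hl') n (bdList_mem l n hl)) hz

theorem bd_eq_zero_of_mem_chains_zero {P : List X → Prop} {z : List X →₀ K}
    (hz : z ∈ chains K P 0) : bd K z = 0 := by
  have := map_mem_of_mem_chains (N := ⊥) (bd K) (fun l hl _ => by
    rw [List.length_eq_zero_iff] at hl
    subst hl
    simp [bdList]) hz
  simpa using this

theorem prismList_mem (f g : X → Y) (l : List X) :
    prismList K f g l ∈
      chains K (fun l' => ∀ y ∈ l', ∃ x ∈ l, y = f x ∨ y = g x) (l.length + 1) := by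
  induction l with
  | nil => simp [prismList]
  | cons x l ih =>
    rw [prismList]
    refine Submodule.sub_mem _ (single_mem_chains (by simp) ?_ 1) ?_
    · intro y hy
      simp only [List.mem_cons, List.mem_map] at hy
      rcases hy with rfl | rfl | ⟨x', hx', rfl⟩
      · exact ⟨x, by simp, Or.inl rfl⟩
      · exact ⟨x, by simp, Or.inr rfl⟩
      · exact ⟨x', by simp [hx'], Or.inr rfl⟩
    · refine cons_mem_chains (fun l' h y hy => ?_) ih
      rcases List.mem_cons.1 hy with rfl | hy
      · exact ⟨x, by simp, Or.inl rfl⟩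
      · obtain ⟨x', hx', h'⟩ := h y hy
        exact ⟨x', by simp [hx'], h'⟩

end Chains

/-! ### Acyclicity of small-tuple complexes of independence complexes -/

section Rips

variable {ι : Type*} [Fintype ι]

/-- Tuples of points of diameter less than `ε` lying in a common face of the independence complex
of the relation `H` on the vertex set `U`. -/
def SmallTuple (H : ι → ι → Prop) (ε : ℝ) (U : Set ι) (l : List (ι → ℝ)) : Prop :=
  ∀ x ∈ l, ∀ y ∈ l, x ∈ stdSimplex ℝ ι ∧ (∀ a, x a ≠ 0 → a ∈ U) ∧
    (∀ a b, x a ≠ 0 → y b ≠ 0 → ¬ H a b) ∧ dist x y < ε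

/-- The augmented complex of small tuples is exact in tuple lengths below `n`. -/
def Acyclic (K : Type*) [Field K] (H : ι → ι → Prop) (ε : ℝ) (U : Set ι) (n : ℕ) : Prop :=
  ∀ j < n, ∀ z ∈ chains K (SmallTuple H ε U) j, bd K z = 0 →
    ∃ w ∈ chains K (SmallTuple H ε U) (j + 1), bd K w = z

theorem SmallTuple.sublist {H : ι → ι → Prop} {ε : ℝ} {U : Set ι} (l l' : List (ι → ℝ))
    (h : l'.Sublist l) (hl : SmallTuple H ε U l) : SmallTuple H ε U l' :=
  fun x hx y hy => hl x (h.subset hx) y (h.subset hy)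

theorem SmallTuple.mono {H : ι → ι → Prop} {ε ε' : ℝ} {U U' : Set ι} (hε : ε ≤ ε') (hU : U ⊆ U')
    (l : List (ι → ℝ)) (hl : SmallTuple H ε U l) : SmallTuple H ε' U' l :=
  fun x hx y hy =>
    let ⟨h1, h2, h3, h4⟩ := hl x hx y hy
    ⟨h1, fun a ha => hU (h2 a ha), h3, h4.trans_le hε⟩

theorem dist_le_one_of_mem_stdSimplex {x y : ι → ℝ} (hx : x ∈ stdSimplex ℝ ι)
    (hy : y ∈ stdSimplex ℝ ι) : dist x y ≤ 1 := by
  refine (dist_pi_le_iff zero_le_one).2 fun i => ?_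
  have h1 := mem_Icc_of_mem_stdSimplex hx i
  have h2 := mem_Icc_of_mem_stdSimplex hy i
  rw [Real.dist_eq, abs_le]
  exact ⟨by linarith [h1.1, h2.2], by linarith [h1.2, h2.1]⟩

theorem exists_smaller_of_mem_chains {K : Type*} [Field K] {H : ι → ι → Prop} {ε : ℝ} {U : Set ι}
    {n : ℕ} {z : List (ι → ℝ) →₀ K} (hz : z ∈ chains K (SmallTuple H ε U) n) :
    ∃ ε' < ε, z ∈ chains K (SmallTuple H ε' U) n := by
  have key : ∀ᶠ ε' in nhdsWithin ε (Set.Iio ε), ∀ l ∈ z.support, ∀ x ∈ l, ∀ y ∈ l,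
      dist x y < ε' := by
    rw [Filter.eventually_all_finset]
    intro l hl
    refine (Filter.eventually_all_finite (List.finite_toSet l)).2 fun x hx => ?_
    refine (Filter.eventually_all_finite (List.finite_toSet l)).2 fun y hy => ?_
    have h := (((Finsupp.mem_supported K z).1 hz hl).2 x hx y hy).2.2.2
    exact mem_nhdsWithin_of_mem_nhds (lt_mem_nhds h)
  obtain ⟨ε', h, hε'⟩ := (key.and self_mem_nhdsWithin).exists
  refine ⟨ε', hε', (Finsupp.mem_supported K z).2 fun l hl => ?_⟩
  have h' := (Finsupp.mem_supported K z).1 hz hl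
  exact ⟨h'.1, fun x hx y hy =>
    let ⟨h1, h2, h3, _⟩ := h'.2 x hx y hy
    ⟨h1, h2, h3, h l hl x hx y hy⟩⟩

variable [DecidableEq ι]

/-- The straight-line contraction of the simplex to the vertex `a`, at time `t`. -/
noncomputable def contraction (a : ι) (t : ℝ) (x : ι → ℝ) : ι → ℝ :=
  (1 - t) • x + t • Pi.single a 1

theorem eq_or_ne_zero_of_contraction {ι : Type*} [DecidableEq ι] {a b : ι} {t : ℝ} {x : ι → ℝ}
    (h : contraction a t x b ≠ 0) : b = a ∨ x b ≠ 0 := by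
  by_contra! hb
  apply h
  simp [contraction, hb.1, hb.2]

theorem contraction_mem {a : ι} {t : ℝ} (ht : t ∈ Set.Icc (0 : ℝ) 1) {x : ι → ℝ}
    (hx : x ∈ stdSimplex ℝ ι) : contraction a t x ∈ stdSimplex ℝ ι :=
  convex_stdSimplex ℝ ι hx (single_mem_stdSimplex ℝ a) (by linarith [ht.2]) ht.1 (by ring)

theorem dist_contraction_left {a : ι} {t : ℝ} (ht : t ∈ Set.Icc (0 : ℝ) 1) (x y : ι → ℝ) :
    dist (contraction a t x) (contraction a t y) ≤ dist x y := by
  have : dist (contraction a t x) (contraction a t y) = |1 - t| * dist x y := by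
    rw [contraction, contraction, dist_add_right, dist_smul₀, Real.norm_eq_abs]
  rw [this, abs_of_nonneg (by linarith [ht.2])]
  nlinarith [dist_nonneg (x := x) (y := y), ht.1]

theorem dist_contraction_right {a : ι} {s t : ℝ} {x : ι → ℝ} (hx : x ∈ stdSimplex ℝ ι) :
    dist (contraction a s x) (contraction a t x) ≤ |s - t| := by
  have h : contraction a s x - contraction a t x = (t - s) • (x - Pi.single a 1) := by
    simp only [contraction]
    module
  rw [dist_eq_norm, h, norm_smul, Real.norm_eq_abs, abs_sub_comm, ← dist_eq_norm]
  have := dist_le_one_of_mem_stdSimplex hx (single_mem_stdSimplex ℝ a)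
  nlinarith [abs_nonneg (s - t)]

theorem acyclic_of_isolated {K : Type*} [Field K] {H : ι → ι → Prop}
    (hH : ∀ a b, H a b → H b a) {ε : ℝ}
    (hε : 0 < ε) {U : Set ι} {a : ι} (ha : a ∈ U) (hU : ∀ b ∈ U, ¬ H a b) (n : ℕ) :
    Acyclic K H ε U n := by
  intro j _ z hz hbd
  obtain ⟨ε', hε', hz'⟩ := exists_smaller_of_mem_chains hz
  obtain ⟨S, hS⟩ := exists_nat_gt (1 / (ε - ε'))
  have hS0 : (0 : ℝ) < S := lt_trans (by have := sub_pos.2 hε'; positivity) hS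
  have hη : ε' + 1 / (S : ℝ) < ε := by
    have := (one_div_lt (sub_pos.2 hε') hS0).1 hS
    linarith
  have hcompat : ∀ {s t : ℝ} {x y : ι → ℝ}, (∀ b, x b ≠ 0 → b ∈ U) → (∀ b, y b ≠ 0 → b ∈ U) →
      (∀ b c, x b ≠ 0 → y c ≠ 0 → ¬ H b c) →
      ∀ b c, contraction a s x b ≠ 0 → contraction a t y c ≠ 0 → ¬ H b c := by
    intro s t x y hx hy hxy b c hb hc hbc
    rcases eq_or_ne_zero_of_contraction hb with rfl | hb'
    · rcases eq_or_ne_zero_of_contraction hc with rfl | hc'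
      · exact hU _ ha hbc
      · exact hU _ (hy _ hc') hbc
    · rcases eq_or_ne_zero_of_contraction hc with rfl | hc'
      · exact hU _ (hx _ hb') (hH _ _ hbc)
      · exact hxy _ _ hb' hc' hbc
  have hsupp : ∀ {s : ℝ} {x : ι → ℝ}, (∀ b, x b ≠ 0 → b ∈ U) →
      ∀ b, contraction a s x b ≠ 0 → b ∈ U := by
    intro s x hx b hb
    rcases eq_or_ne_zero_of_contraction hb with rfl | hb'
    exacts [ha, hx _ hb']
  have htime : ∀ s : ℕ, s ≤ S → (s / S : ℝ) ∈ Set.Icc (0 : ℝ) 1 := fun s hs =>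
    ⟨by positivity, (div_le_one hS0).2 (by exact_mod_cast hs)⟩
  have hstep : ∀ s : ℕ, s + 1 ≤ S →
      prism K (contraction a (s / S)) (contraction a ((s + 1 : ℕ) / S)) z ∈
        chains K (SmallTuple H ε U) (j + 1) := by
    intro s hs
    have h0 := htime s (by omega)
    have h1 := htime (s + 1) hs
    have habs : |((s : ℝ) / S) - ((s + 1 : ℕ) : ℝ) / S| = 1 / S := by
      rw [← sub_div, abs_div, abs_of_pos hS0]
      push_cast
      norm_num
    refine map_mem_of_mem_chains _ (fun l hl hP => ?_) hz'
    rw [prism_single, ← hl]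
    refine chains_mono (fun l' hl' => ?_) _ (prismList_mem _ _ l)
    intro p hp r hr
    obtain ⟨x, hx, hpx⟩ := hl' p hp
    obtain ⟨y, hy, hry⟩ := hl' r hr
    obtain ⟨hx1, hx2, hxy, hd⟩ := hP x hx y hy
    obtain ⟨hy1, hy2, -, -⟩ := hP y hy x hx
    have hd1 := (dist_contraction_left (a := a) h0 x y).trans_lt hd
    have hd2 := (dist_contraction_left (a := a) h1 x y).trans_lt hd
    have hdy := (dist_contraction_right (a := a) (s := s / S) (t := (s + 1 : ℕ) / S) hy1).trans_eq
      habs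
    have hpos : (0 : ℝ) < 1 / S := by positivity
    rcases hpx with rfl | rfl <;> rcases hry with rfl | rfl
    · exact ⟨contraction_mem h0 hx1, hsupp hx2, hcompat hx2 hy2 hxy, by linarith⟩
    · refine ⟨contraction_mem h0 hx1, hsupp hx2, hcompat hx2 hy2 hxy, ?_⟩
      linarith [dist_triangle (contraction a (s / S) x) (contraction a (s / S) y)
        (contraction a ((s + 1 : ℕ) / S) y)]
    · refine ⟨contraction_mem h1 hx1, hsupp hx2, hcompat hx2 hy2 hxy, ?_⟩
      rw [dist_comm] at hdy
      linarith [dist_triangle (contraction a ((s + 1 : ℕ) / S) x)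
        (contraction a ((s + 1 : ℕ) / S) y) (contraction a (s / S) y)]
    · exact ⟨contraction_mem h1 hx1, hsupp hx2, hcompat hx2 hy2 hxy, by linarith⟩
  have hiter : ∀ s : ℕ, s ≤ S → ∃ w ∈ chains K (SmallTuple H ε U) (j + 1),
      bd K w = z - push K (contraction a (s / S)) z := by
    intro s
    induction s with
    | zero =>
      intro _
      refine ⟨0, Submodule.zero_mem _, ?_⟩
      have : contraction a ((0 : ℕ) / S : ℝ) = id := by
        ext x b
        simp [contraction]
      rw [this]
      simp [push]
    | succ s ih =>
      intro hs
      obtain ⟨w, hw, hbw⟩ := ih (by omega)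
      refine ⟨w - prism K (contraction a (s / S)) (contraction a ((s + 1 : ℕ) / S)) z,
        Submodule.sub_mem _ hw (hstep s hs), ?_⟩
      rw [map_sub, hbw, bd_prism, hbd, map_zero]
      abel
  obtain ⟨w, hw, hbw⟩ := hiter S le_rfl
  have hone : ∀ x, contraction a ((S : ℝ) / S) x = Pi.single a 1 := by
    intro x
    rw [div_self hS0.ne']
    simp [contraction]
  refine ⟨w + cons K (Pi.single a 1) (push K (contraction a (S / S)) z), ?_, ?_⟩
  · refine Submodule.add_mem _ hw (cons_mem_chains (P := fun l => ∀ x ∈ l, x = Pi.single a 1)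
      (fun l hl => ?_) (push_mem_chains (fun l _ => ?_) hz))
    · have hl' : ∀ x ∈ (Pi.single a 1 : ι → ℝ) :: l, x = Pi.single a 1 := by simpa using hl
      have hs : ∀ b, (Pi.single a 1 : ι → ℝ) b ≠ 0 → b = a := by
        intro b hb
        by_contra hne
        exact hb (by simp [hne])
      intro x hx y hy
      rw [hl' x hx, hl' y hy]
      refine ⟨single_mem_stdSimplex ℝ a, fun b hb => hs b hb ▸ ha, fun b c hb hc => ?_, by simpa⟩
      rw [hs b hb, hs c hc]
      exact hU a ha
    · intro x hx
      obtain ⟨y, _, rfl⟩ := List.mem_map.1 hx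
      exact hone y
  · rw [map_add, hbw, bd_cons, bd_push, hbd]
    simp

theorem acyclic_of_delete {K : Type*} [Field K] {H : ι → ι → Prop}
    (hH : ∀ a b, H a b → H b a) {ε : ℝ}
    (hε : 0 < ε) {U : Set ι} {a : ι} (haa : ¬ H a a) {n : ℕ}
    (h1 : Acyclic K H ε (U \ {a}) (n + 1))
    (h2 : Acyclic K H ε (U \ {b | b = a ∨ H a b}) n) : Acyclic K H ε U (n + 1) := by
  classical
  by_cases haU : a ∈ U
  swap
  · rwa [Set.sdiff_singleton_eq_self haU] at h1
  intro j hj z hz hbd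
  set St : Set ι := U \ {b | H a b} with hSt
  have haSt : a ∈ St := ⟨haU, haa⟩
  have hStar : Acyclic K H ε St (n + 1) :=
    acyclic_of_isolated hH hε haSt (fun b hb => hb.2) _
  set z1 := z.filter (SmallTuple H ε (U \ {a}))
  set z2 := z.filter (fun l => ¬ SmallTuple H ε (U \ {a}) l)
  have hz12 : z1 + z2 = z := Finsupp.filter_add_filter_not z _
  have hz1 : z1 ∈ chains K (SmallTuple H ε (U \ {a})) j := by
    refine (Finsupp.mem_supported K _).2 fun l hl => ?_
    rw [Finset.mem_coe, Finsupp.support_filter, Finset.mem_filter] at hl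
    exact ⟨((Finsupp.mem_supported K z).1 hz hl.1).1, hl.2⟩
  have hz2 : z2 ∈ chains K (SmallTuple H ε St) j := by
    refine (Finsupp.mem_supported K _).2 fun l hl => ?_
    rw [Finset.mem_coe, Finsupp.support_filter, Finset.mem_filter] at hl
    obtain ⟨hlen, hl1⟩ := (Finsupp.mem_supported K z).1 hz hl.1
    refine ⟨hlen, ?_⟩
    have : ∃ x ∈ l, x a ≠ 0 := by
      by_contra! hno
      refine hl.2 fun x hx y hy => ?_
      obtain ⟨g1, g2, g3, g4⟩ := hl1 x hx y hy
      refine ⟨g1, fun b hb => ⟨g2 b hb, ?_⟩, g3, g4⟩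
      rintro rfl
      exact hb (hno x hx)
    obtain ⟨x0, hx0, hx0a⟩ := this
    intro x hx y hy
    obtain ⟨g1, g2, g3, g4⟩ := hl1 x hx y hy
    exact ⟨g1, fun b hb => ⟨g2 b hb, (hl1 x0 hx0 x hx).2.2.1 a b hx0a hb⟩, g3, g4⟩
  have hbd12 : bd K z1 = - bd K z2 := by
    rw [eq_neg_iff_add_eq_zero, ← map_add, hz12, hbd]
  have hc : ∃ c ∈ chains K (SmallTuple H ε (U \ {b | b = a ∨ H a b})) j, bd K c = bd K z1 := by
    cases j with
    | zero =>
      exact ⟨0, Submodule.zero_mem _, by rw [bd_eq_zero_of_mem_chains_zero hz1, map_zero]⟩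
    | succ j =>
      refine h2 j (by omega) _ ?_ (bd_bd _)
      have m1 := bd_mem_chains SmallTuple.sublist hz1
      have m2 : bd K z1 ∈ chains K (SmallTuple H ε St) j := by
        rw [hbd12]
        exact Submodule.neg_mem _ (bd_mem_chains SmallTuple.sublist hz2)
      refine (Finsupp.mem_supported K _).2 fun l hl => ?_
      obtain ⟨hlen, hl1⟩ := (Finsupp.mem_supported K _).1 m1 hl
      obtain ⟨-, hl2⟩ := (Finsupp.mem_supported K _).1 m2 hl
      refine ⟨hlen, fun x hx y hy => ?_⟩
      obtain ⟨g1, g2, g3, g4⟩ := hl1 x hx y hy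
      refine ⟨g1, fun b hb => ⟨(g2 b hb).1, ?_⟩, g3, g4⟩
      rintro (rfl | hab)
      · exact (g2 _ hb).2 rfl
      · exact ((hl2 x hx y hy).2.1 b hb).2 hab
  obtain ⟨c, hc, hbc⟩ := hc
  have hsub1 : U \ {b | b = a ∨ H a b} ⊆ U \ {a} := fun b hb => ⟨hb.1, fun h => hb.2 (Or.inl h)⟩
  have hsub2 : U \ {b | b = a ∨ H a b} ⊆ St := fun b hb => ⟨hb.1, fun h => hb.2 (Or.inr h)⟩
  have hc1 := chains_mono (K := K) (SmallTuple.mono (H := H) (ε := ε) le_rfl hsub1) _ hc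
  have hc2 := chains_mono (K := K) (SmallTuple.mono (H := H) (ε := ε) le_rfl hsub2) _ hc
  obtain ⟨w1, hw1, hbw1⟩ := h1 j hj (z1 - c) (Submodule.sub_mem _ hz1 hc1) (by
    rw [map_sub, hbc, sub_self])
  obtain ⟨w2, hw2, hbw2⟩ := hStar j hj (z2 + c) (Submodule.add_mem _ hz2 hc2) (by
    rw [map_add, hbc, hbd12, add_neg_cancel])
  refine ⟨w1 + w2, Submodule.add_mem _
    (chains_mono (SmallTuple.mono le_rfl Set.sdiff_subset) _ hw1)
    (chains_mono (SmallTuple.mono le_rfl Set.sdiff_subset) _ hw2), ?_⟩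
  rw [map_add, hbw1, hbw2, ← hz12]
  abel

end Rips

/-! ### Independence complexes of color lists -/

theorem acyclic_of_remove {ι : Type*} [Fintype ι] [DecidableEq ι] {K : Type*} [Field K]
    {H : ι → ι → Prop} (hH : ∀ a b, H a b → H b a) (hirr : ∀ a, ¬ H a a) {ε : ℝ} (hε : 0 < ε)
    {n : ℕ} (B : Finset ι) {U : Set ι} (h1 : Acyclic K H ε (U \ B) (n + 1))
    (h2 : ∀ a ∈ B, ∀ B' ⊆ B, Acyclic K H ε ((U \ B') \ {b | b = a ∨ H a b}) n) :
    Acyclic K H ε U (n + 1) := by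
  induction B using Finset.induction_on generalizing U with
  | empty => simpa using h1
  | insert a s _ ih =>
    have hU : ∀ t : Finset ι, U \ ((insert a t : Finset ι) : Set ι) = (U \ {a}) \ t := fun t => by
      rw [Finset.coe_insert, Set.insert_eq, Set.sdiff_sdiff]
    refine acyclic_of_delete hH hε (hirr a) (ih ?_ fun b hb B' hB' => ?_) ?_
    · rwa [← hU]
    · rw [← hU]
      exact h2 b (Finset.mem_insert_of_mem hb) _ (Finset.insert_subset_insert a hB')
    · simpa using h2 a (Finset.mem_insert_self a s) ∅ (Finset.empty_subset _)

/-- Vertex-color pairs that cannot both be used in a proper coloring. -/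
def Conflict {V : Type*} (G : SimpleGraph V) (F : Type*) (a b : V × F) : Prop :=
  (a.1 = b.1 ∧ a.2 ≠ b.2) ∨ (G.Adj a.1 b.1 ∧ a.2 = b.2)

section Lists

variable {V F : Type*} {G : SimpleGraph V}

theorem Conflict.symm {a b : V × F} (h : Conflict G F a b) : Conflict G F b a :=
  h.imp (fun h => ⟨h.1.symm, h.2.symm⟩) (fun h => ⟨h.1.symm, h.2.symm⟩)

theorem Conflict.irrefl (a : V × F) : ¬ Conflict G F a a := by
  simp [Conflict]

theorem dist_eq_two_of_adj {u v w : V} (huv : G.Adj u v) (hvw : G.Adj v w)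
    (hne : u ≠ w) (huw : ¬ G.Adj u w) : G.dist u w = 2 := by
  have hr : G.Reachable u w := huv.reachable.trans hvw.reachable
  have h0 : G.dist u w ≠ 0 := fun h => hne (hr.dist_eq_zero_iff.1 h)
  have h1 : G.dist u w ≠ 1 := fun h => huw (SimpleGraph.dist_eq_one_iff_adj.1 h)
  have h2 : G.dist u w ≤ 2 := by
    simpa using SimpleGraph.dist_le (SimpleGraph.Walk.cons huv (SimpleGraph.Walk.cons hvw .nil))
  omega

variable [Fintype V] [Fintype F]

open Classical in
theorem acyclic_of_lists {K : Type*} [Field K] {ε : ℝ} (hε : 0 < ε) (n : ℕ) (W : Finset V)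
    (hW : W.card = n) (U : Set (V × F)) (hU : ∀ a ∈ U, a.1 ∈ W)
    (hcard : ∀ v ∈ W, (W.filter fun u => G.dist v u = 2).card + 2 * (W.filter (G.Adj v)).card <
      (Finset.univ.filter fun i => (v, i) ∈ U).card) :
    Acyclic K (Conflict G F) ε U n := by
  induction n generalizing W U with
  | zero => exact fun j hj => absurd hj (Nat.not_lt_zero j)
  | succ n ih =>
    have hsymm : ∀ a b : V × F, Conflict G F a b → Conflict G F b a := fun _ _ => Conflict.symm
    obtain ⟨v, hv⟩ : W.Nonempty := Finset.card_pos.1 (by omega)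
    obtain ⟨i₀, hi₀⟩ : (Finset.univ.filter fun i => (v, i) ∈ U).Nonempty :=
      Finset.card_pos.1 (by have := hcard v hv; omega)
    have hi₀ : (v, i₀) ∈ U := by simpa using hi₀
    -- removing a pair with first coordinate `w` and passing to its link
    have hlink : ∀ a : V × F, a.1 ∈ W → ∀ U' ⊆ U,
        (∀ u ∈ W.erase a.1, ∃ T : Finset F,
          (∀ i ∉ T, (u, i) ∈ U → (u, i) ∈ U' ∧ ¬ Conflict G F a (u, i)) ∧
          (T.card = 0 ∨ (T.card ≤ 1 ∧ G.dist u a.1 = 2) ∨ (T.card ≤ 2 ∧ G.Adj u a.1))) →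
        Acyclic K (Conflict G F) ε (U' \ {b | b = a ∨ Conflict G F a b}) n := by
      intro a ha U' hU' hT
      refine ih (W.erase a.1) (by rw [Finset.card_erase_of_mem ha, hW]; rfl) _ ?_ ?_
      · rintro b ⟨hb, hb'⟩
        refine Finset.mem_erase.2 ⟨fun h => hb' ?_, hU b (hU' hb)⟩
        by_cases h2 : b.2 = a.2
        · exact Or.inl (Prod.ext h h2)
        · exact Or.inr (Or.inl ⟨h.symm, fun h => h2 h.symm⟩)
      · intro u hu
        obtain ⟨T, hT1, hT2⟩ := hT u hu
        have hua := (Finset.mem_erase.1 hu).1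
        have hsub : (Finset.univ.filter fun i => (u, i) ∈ U) \ T ⊆
            Finset.univ.filter fun i => (u, i) ∈ U' \ {b | b = a ∨ Conflict G F a b} := by
          intro i hi
          simp only [Finset.mem_sdiff, Finset.mem_filter, Finset.mem_univ, true_and] at hi ⊢
          obtain ⟨g1, g2⟩ := hT1 i hi.2 hi.1
          refine ⟨g1, ?_⟩
          rintro (h | h)
          · exact hua (by rw [← h])
          · exact g2 h
        have h1 := (Finset.le_card_sdiff T _).trans (Finset.card_le_card hsub)
        have h2 := hcard u (Finset.mem_of_mem_erase hu)
        have h3 : ((W.erase a.1).filter fun u' => G.dist u u' = 2).card ≤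
            (W.filter fun u' => G.dist u u' = 2).card :=
          Finset.card_le_card (Finset.filter_subset_filter _ (Finset.erase_subset _ _))
        have h4 : ((W.erase a.1).filter (G.Adj u)).card ≤ (W.filter (G.Adj u)).card :=
          Finset.card_le_card (Finset.filter_subset_filter _ (Finset.erase_subset _ _))
        refine lt_of_lt_of_le ?_ (h1.trans_eq (by congr!))
        rcases hT2 with h | ⟨h, hd⟩ | ⟨h, hd⟩
        · omega
        · have h5 : ((W.erase a.1).filter fun u' => G.dist u u' = 2).card <
              (W.filter fun u' => G.dist u u' = 2).card := by
            rw [Finset.filter_erase]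
            exact Finset.card_erase_lt_of_mem (by simp [ha, hd])
          omega
        · have h5 : ((W.erase a.1).filter (G.Adj u)).card < (W.filter (G.Adj u)).card := by
            rw [Finset.filter_erase]
            exact Finset.card_erase_lt_of_mem (by simp [ha, hd])
          omega
    set B₁ : Finset (V × F) := (W.filter (G.Adj v)).image fun w => (w, i₀) with hB₁
    set B₂ : Finset (V × F) := (Finset.univ.erase i₀).image fun j => (v, j) with hB₂
    have mem_B₁ : ∀ a, a ∈ B₁ → G.Adj v a.1 ∧ a.1 ∈ W ∧ a.2 = i₀ := by
      intro a ha
      obtain ⟨w, hw, rfl⟩ := Finset.mem_image.1 ha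
      rw [Finset.mem_filter] at hw
      exact ⟨hw.2, hw.1, rfl⟩
    have mem_B₂ : ∀ a, a ∈ B₂ → a.1 = v ∧ a.2 ≠ i₀ := by
      intro a ha
      obtain ⟨w, hw, rfl⟩ := Finset.mem_image.1 ha
      exact ⟨rfl, (Finset.mem_erase.1 hw).1⟩
    refine acyclic_of_remove hsymm Conflict.irrefl hε B₁
      (acyclic_of_remove hsymm Conflict.irrefl hε B₂ ?_ ?_) ?_
    · have hmem : (v, i₀) ∈ (U \ B₁) \ B₂ :=
        ⟨⟨hi₀, fun h => (mem_B₁ _ h).1.ne rfl⟩, fun h => (mem_B₂ _ h).2 rfl⟩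
      refine acyclic_of_isolated hsymm hε hmem ?_ _
      rintro ⟨u, i⟩ ⟨⟨hu, hu1⟩, hu2⟩ (⟨h1, h2⟩ | ⟨h1, h2⟩)
      · refine hu2 (Finset.mem_coe.2 (Finset.mem_image.2 ⟨i, ?_, ?_⟩))
        · exact Finset.mem_erase.2 ⟨fun h => h2 h.symm, Finset.mem_univ _⟩
        · exact Prod.ext h1 rfl
      · refine hu1 (Finset.mem_coe.2 (Finset.mem_image.2 ⟨u, ?_, ?_⟩))
        · exact Finset.mem_filter.2 ⟨hU _ hu, h1⟩
        · exact Prod.ext rfl h2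
    · intro a ha B' hB'
      obtain ⟨ha1, ha2⟩ := mem_B₂ a ha
      refine hlink a (ha1 ▸ hv) _ (Set.sdiff_subset.trans Set.sdiff_subset) fun u hu => ?_
      have huv : u ≠ v := ha1 ▸ (Finset.mem_erase.1 hu).1
      by_cases hadj : G.Adj v u
      · refine ⟨{i₀, a.2}, fun i hi hui => ?_, Or.inr (Or.inr ⟨Finset.card_le_two, ?_⟩)⟩
        · simp only [Finset.mem_insert, Finset.mem_singleton, not_or] at hi
          refine ⟨⟨⟨hui, fun h => hi.1 (mem_B₁ _ h).2.2⟩, fun h => huv (mem_B₂ _ (hB' h)).1⟩, ?_⟩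
          rintro (⟨h, -⟩ | ⟨-, h⟩)
          · exact huv (h.symm.trans ha1)
          · exact hi.2 h.symm
        · rw [ha1]
          exact hadj.symm
      · refine ⟨∅, fun i _ hui => ⟨⟨⟨hui, fun h => hadj (mem_B₁ _ h).1⟩,
          fun h => huv (mem_B₂ _ (hB' h)).1⟩, ?_⟩, Or.inl rfl⟩
        rintro (⟨h, -⟩ | ⟨h, -⟩)
        · exact huv (h.symm.trans ha1)
        · exact hadj (ha1 ▸ h)
    · intro a ha B' hB'
      obtain ⟨ha1, ha2, ha3⟩ := mem_B₁ a ha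
      refine hlink a ha2 _ Set.sdiff_subset fun u hu => ?_
      have hua := (Finset.mem_erase.1 hu).1
      have hi : ∀ i ∉ ({i₀} : Finset F), (u, i) ∈ U →
          (u, i) ∈ U \ B' ∧ ¬ Conflict G F a (u, i) := by
        intro i hi hui
        rw [Finset.mem_singleton] at hi
        refine ⟨⟨hui, fun h => hi (mem_B₁ _ (hB' h)).2.2⟩, ?_⟩
        rintro (⟨h, -⟩ | ⟨-, h⟩)
        · exact hua h.symm
        · exact hi (h.symm.trans ha3)
      by_cases h1 : G.Adj u a.1
      · exact ⟨{i₀}, hi, Or.inr (Or.inr ⟨by simp, h1⟩)⟩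
      by_cases h2 : G.Adj v u
      · exact ⟨{i₀}, hi, Or.inr (Or.inl ⟨by simp, dist_eq_two_of_adj h2.symm ha1 hua h1⟩)⟩
      · refine ⟨∅, fun i _ hui => ⟨⟨hui, fun h => h2 (mem_B₁ _ (hB' h)).1⟩, ?_⟩, Or.inl rfl⟩
        rintro (⟨h, -⟩ | ⟨h, -⟩)
        · exact hua h.symm
        · exact h1 h.symm

/-- The complex of partial proper colorings is highly connected under the degree bound. -/
theorem acyclic_univ {K : Type*} [Field K] [DecidableRel G.Adj] {ε : ℝ} (hε : 0 < ε)
    (hdeg : ∀ v : V, ({u : V | G.dist v u = 2} : Set V).ncard + 2 * G.degree v < Fintype.card F) :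
    Acyclic K (Conflict G F) ε Set.univ (Fintype.card V) := by
  classical
  refine acyclic_of_lists hε _ Finset.univ rfl _ (fun _ _ => Finset.mem_univ _) fun v _ => ?_
  have := hdeg v
  rw [← G.card_neighborFinset_eq_degree, G.neighborFinset_eq_filter,
    Set.ncard_eq_toFinset_card', Set.toFinset_ofPred] at this
  simp only [Set.mem_univ, Finset.filter_true, Finset.card_univ]
  convert this

end Lists

/-! ### Operators on chains in positive characteristic -/

theorem sum_pow_char_of_commute {R ι : Type*} [Ring R] (p : ℕ) [Fact p.Prime] [CharP R p]
    (s : Finset ι) (x : ι → R) (h : ∀ i j, Commute (x i) (x j)) :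
    (∑ i ∈ s, x i) ^ p = ∑ i ∈ s, x i ^ p := by
  classical
  induction s using Finset.induction_on with
  | empty => simp [(Fact.out : p.Prime).ne_zero]
  | insert a s ha ih =>
    rw [Finset.sum_insert ha, Finset.sum_insert ha, add_pow_char_of_commute p, ih]
    exact Commute.sum_right _ _ _ fun j _ => h a j

theorem sum_smul_sub_one_pow_char {R K ι : Type*} [Ring R] [Field K] [Algebra K R] [Fintype ι]
    (p : ℕ) [Fact p.Prime] [CharP R p] (b : ι → K) {e : ι → R} (h : ∀ i j, Commute (e i) (e j))
    (he : ∀ i, e i ^ p = 1) : (∑ i, b i • (e i - 1)) ^ p = 0 := by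
  rw [sum_pow_char_of_commute p]
  · refine Finset.sum_eq_zero fun k _ => ?_
    rw [smul_pow, sub_pow_char_of_commute p (Commute.one_right _), he, one_pow, sub_self, smul_zero]
  · intro k k'
    exact (((h k k').sub_left (Commute.one_left _)).sub_right (Commute.one_right _)).smul_left _
      |>.smul_right _

/-- A Weyl-algebra exactness property: if `t` has a partner `y` with `t y - y t = 1` on `S`, then,
modulo `D`, the kernel of `t ^ k` on `S` is in the image of `t ^ (p - k)`. -/
theorem exists_pow_of_weyl {K M : Type*} [Field K] [AddCommGroup M] [Module K M] (p : ℕ)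
    [hp : Fact p.Prime] [CharP K p] {t y : Module.End K M} {S D : Submodule K M}
    (htS : ∀ v ∈ S, t v ∈ S) (hyS : ∀ v ∈ S, y v ∈ S)
    (htD : ∀ v ∈ D, t v ∈ D) (hyD : ∀ v ∈ D, y v ∈ D)
    (hty : ∀ v ∈ S, t (y v) = y (t v) + v) {k : ℕ} (hk : k < p) {v : M} (hv : v ∈ S)
    (hkv : (t ^ k) v ∈ D) : ∃ m ∈ S, v - (t ^ (p - k)) m ∈ D := by
  have pow_mem : ∀ {f : Module.End K M} {E : Submodule K M}, (∀ v ∈ E, f v ∈ E) →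
      ∀ n, ∀ v ∈ E, (f ^ n) v ∈ E := by
    intro f E hf n
    induction n with
    | zero => exact fun v hv => hv
    | succ n ih =>
      intro v hv
      rw [pow_succ', Module.End.mul_apply]
      exact hf _ (ih v hv)
  have hcomm : ∀ n : ℕ, ∀ v ∈ S,
      t ((y ^ (n + 1)) v) = (y ^ (n + 1)) (t v) + (n + 1 : K) • (y ^ n) v := by
    intro n
    induction n with
    | zero => intro v hv; simpa using hty v hv
    | succ n ih =>
      intro v hv
      rw [pow_succ' y (n + 1), Module.End.mul_apply, hty _ (pow_mem hyS _ _ hv), ih v hv, map_add,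
        map_smul, Module.End.mul_apply, ← Module.End.mul_apply y (y ^ n), ← pow_succ']
      push_cast
      module
  have hfact : ∀ n : ℕ, ∀ v ∈ S, t v ∈ D → (t ^ n) ((y ^ n) v) - (n.factorial : K) • v ∈ D := by
    intro n
    induction n with
    | zero => intro v _ _; simp
    | succ n ih =>
      intro v hv htv
      have h1 : (t ^ (n + 1)) ((y ^ (n + 1)) v) =
          (t ^ n) ((y ^ (n + 1)) (t v)) + (n + 1 : K) • (t ^ n) ((y ^ n) v) := by
        rw [pow_succ t, Module.End.mul_apply, hcomm n v hv, map_add, map_smul]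
      have h2 : (t ^ (n + 1)) ((y ^ (n + 1)) v) - ((n + 1).factorial : K) • v =
          (t ^ n) ((y ^ (n + 1)) (t v)) +
            (n + 1 : K) • ((t ^ n) ((y ^ n) v) - (n.factorial : K) • v) := by
        rw [h1, Nat.factorial_succ]
        push_cast
        module
      rw [h2]
      exact D.add_mem (pow_mem htD _ _ (pow_mem hyD _ _ htv)) (D.smul_mem _ (ih v hv htv))
  have hone : ∀ v ∈ S, t v ∈ D → ∃ m ∈ S, v - (t ^ (p - 1)) m ∈ D := by
    intro v hv htv
    have hne : ((p - 1).factorial : K) ≠ 0 := by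
      rw [Ne, CharP.cast_eq_zero_iff K p, hp.out.dvd_factorial]
      have := hp.out.pos
      omega
    refine ⟨((p - 1).factorial : K)⁻¹ • (y ^ (p - 1)) v, S.smul_mem _ (pow_mem hyS _ _ hv), ?_⟩
    have := D.smul_mem (-((p - 1).factorial : K)⁻¹) (hfact (p - 1) v hv htv)
    rwa [smul_sub, smul_smul, neg_mul, inv_mul_cancel₀ hne, neg_smul, neg_smul, one_smul,
      sub_neg_eq_add, neg_add_eq_sub, ← map_smul] at this
  induction k generalizing v with
  | zero => exact ⟨0, S.zero_mem, by simpa using hkv⟩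
  | succ k ih =>
    rw [pow_succ, Module.End.mul_apply] at hkv
    obtain ⟨m, hm, hvm⟩ := ih (by omega) (htS v hv) hkv
    obtain ⟨m', hm', hvm'⟩ := hone (v - (t ^ (p - (k + 1))) m)
      (S.sub_mem hv (pow_mem htS _ _ hm)) (by
      rwa [map_sub, ← Module.End.mul_apply t, ← pow_succ',
        show p - (k + 1) + 1 = p - k by omega])
    refine ⟨m + (t ^ k) m', S.add_mem hm (pow_mem htS _ _ hm'), ?_⟩
    rwa [map_add, ← Module.End.mul_apply, ← pow_add, show p - (k + 1) + k = p - 1 by omega,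
      ← sub_sub]

section Operators

variable {K : Type*} [Field K] {X Y κ : Type*} [Fintype κ]

/-- The chain endomorphism `∑ k, b k • (s k - 1)`. -/
noncomputable def twist (b : κ → K) (s : κ → X → X) : Module.End K (List X →₀ K) :=
  ∑ k, b k • (push K (s k) - 1)

/-- The diagonal operator scaling each tuple `l` by `f l`. -/
noncomputable def diag (f : List X → K) : Module.End K (List X →₀ K) :=
  Finsupp.linearCombination K fun l => Finsupp.single l (f l)

theorem diag_single (f : List X → K) (l : List X) (a : K) :
    diag f (Finsupp.single l a) = f l • Finsupp.single l a := by
  simp [diag, mul_comm]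

theorem diag_mul (f g : List X → K) : diag f * diag g = diag fun l => f l * g l :=
  linearMap_ext_list fun l => by
    simp [diag_single]

theorem diag_pow (f : List X → K) (n : ℕ) : diag f ^ n = diag fun l => f l ^ n := by
  induction n with
  | zero => exact linearMap_ext_list fun l => by simp [diag_single]
  | succ n ih => rw [pow_succ, ih, diag_mul]; simp only [pow_succ]

theorem push_mul_diag (s : X → X) {f : List X → K} (hf : ∀ l, f (l.map s) = f l) :
    push K s * diag f = diag f * push K s :=
  linearMap_ext_list fun l => by simp [diag_single, hf]

theorem push_push (s t : X → X) : push K s * push K t = push K (s ∘ t) :=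
  linearMap_ext_list fun l => by simp

theorem push_pow (s : X → X) (n : ℕ) : push K s ^ n = push K s^[n] := by
  induction n with
  | zero => exact linearMap_ext_list fun l => by simp
  | succ n ih => rw [pow_succ, ih, push_push, Function.iterate_succ]

theorem push_id : push K (id : X → X) = 1 :=
  linearMap_ext_list fun l => by simp

theorem charP_end (p : ℕ) [CharP K p] : CharP (Module.End K (List X →₀ K)) p :=
  charP_of_injective_algebraMap (algebraMap K (Module.End K (List X →₀ K))).injective p

theorem bd_twist (b : κ → K) (s : κ → X → X) (z : List X →₀ K) :
    bd K (twist b s z) = twist b s (bd K z) := by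
  simp [twist, LinearMap.sum_apply, bd_push]

theorem bd_twist_pow (b : κ → K) (s : κ → X → X) (n : ℕ) (z : List X →₀ K) :
    bd K ((twist b s ^ n) z) = (twist b s ^ n) (bd K z) := by
  induction n generalizing z with
  | zero => rfl
  | succ n ih => rw [pow_succ, Module.End.mul_apply, ih, bd_twist, Module.End.mul_apply]

theorem twist_nil (b : κ → K) (s : κ → X → X) (c : K) :
    twist b s (Finsupp.single [] c) = 0 := by
  simp [twist, LinearMap.sum_apply]

theorem twist_mem_chains {P : List X → Prop} (b : κ → K) {s : κ → X → X}
    (hP : ∀ k l, P l → P (l.map (s k))) {n : ℕ} {z : List X →₀ K} (hz : z ∈ chains K P n) :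
    twist b s z ∈ chains K P n := by
  rw [twist, LinearMap.sum_apply]
  exact Submodule.sum_mem _ fun k _ => Submodule.smul_mem _ _
    (Submodule.sub_mem _ (push_mem_chains (hP k) hz) hz)

theorem twist_pow_mem_chains {P : List X → Prop} (b : κ → K) {s : κ → X → X}
    (hP : ∀ k l, P l → P (l.map (s k))) {n : ℕ} (m : ℕ) {z : List X →₀ K}
    (hz : z ∈ chains K P n) : (twist b s ^ m) z ∈ chains K P n := by
  induction m with
  | zero => exact hz
  | succ m ih =>
    rw [pow_succ', Module.End.mul_apply]
    exact twist_mem_chains b hP ih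

theorem push_twist {P : List X → Prop} (b : κ → K) {s : κ → X → X} {s' : κ → Y → Y} {f : X → Y}
    (hP : ∀ l, P l → ∀ x ∈ l, ∀ k, f (s k x) = s' k (f x)) {n : ℕ} {z : List X →₀ K}
    (hz : z ∈ chains K P n) : push K f (twist b s z) = twist b s' (push K f z) := by
  have := map_mem_of_mem_chains (N := ⊥) ((push K f).comp (twist b s) -
    LinearMap.comp (twist b s') (push K f)) (fun l _ hl => by
      have : ∀ k, l.map (f ∘ s k) = l.map (s' k ∘ f) := fun k =>
        List.map_congr_left fun x hx => hP l hl x hx k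
      simp [twist, this]) hz
  exact sub_eq_zero.1 (by simpa using this)

theorem push_twist_pow {P : List X → Prop} (b : κ → K) {s : κ → X → X} {s' : κ → Y → Y}
    {f : X → Y} (hs : ∀ k l, P l → P (l.map (s k)))
    (hP : ∀ l, P l → ∀ x ∈ l, ∀ k, f (s k x) = s' k (f x)) {n : ℕ} (m : ℕ) {z : List X →₀ K}
    (hz : z ∈ chains K P n) :
    push K f ((twist b s ^ m) z) = (twist b s' ^ m) (push K f z) := by
  induction m with
  | zero => rfl
  | succ m ih =>
    rw [pow_succ', Module.End.mul_apply, push_twist b hP (twist_pow_mem_chains b hs m hz), ih,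
      pow_succ', Module.End.mul_apply]

theorem twist_pow_char (p : ℕ) [Fact p.Prime] [CharP K p] (b : κ → K) {s : κ → X → X}
    (hcomm : ∀ k k', s k ∘ s k' = s k' ∘ s k) (hs : ∀ k, (s k)^[p] = id) :
    twist b s ^ p = 0 := by
  have := charP_end (X := X) (K := K) p
  refine sum_smul_sub_one_pow_char p b (e := fun k => (push K (s k) : Module.End K (List X →₀ K)))
    (fun k k' => ?_) fun k => ?_
  · rw [Commute, SemiconjBy, push_push, push_push, hcomm]
  · rw [push_pow, hs, push_id]

end Operators

/-! ### A Weyl partner for the twist operator -/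

theorem weyl_partner {R : Type*} [Ring R] {t u a e : R} {n : ℕ} (htu : Commute t u)
    (hte : Commute t e) (hue : Commute u e) (hta : t * a = a * t - u) :
    t * (-(u ^ n * e * a)) = -(u ^ n * e * a) * t + u ^ (n + 1) * e := by
  have h1 : t * (u ^ n * e) = u ^ n * e * t := (htu.pow_right n).mul_right hte
  calc t * (-(u ^ n * e * a)) = -(t * (u ^ n * e) * a) := by noncomm_ring
    _ = -(u ^ n * e * (t * a)) := by rw [h1]; noncomm_ring
    _ = -(u ^ n * e * a) * t + u ^ n * (e * u) := by rw [hta]; noncomm_ring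
    _ = _ := by rw [← hue.eq, pow_succ]; noncomm_ring

section Sums

variable {R K κ : Type*} [Ring R] [Field K] [Algebra K R] [Fintype κ] (b : κ → K) {e d : κ → R}

theorem commute_sum_smul_sub_one {x : R} (h : ∀ k, Commute (e k) x) :
    Commute (∑ k, b k • (e k - 1)) x :=
  Commute.sum_left _ _ _ fun k _ => ((h k).sub_left (Commute.one_left x)).smul_left (b k)

theorem commute_sum_smul_mul {x : R} (h : ∀ k, Commute (e k) x) (h' : ∀ k, Commute (d k) x) :
    Commute (∑ k, b k • (e k * d k)) x :=
  Commute.sum_left _ _ _ fun k _ => ((h k).mul_left (h' k)).smul_left (b k)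

theorem commute_sum_sum (he : ∀ k k', Commute (e k) (e k')) (hed : ∀ k k', Commute (e k) (d k')) :
    Commute (∑ k, b k • (e k - 1)) (∑ k, b k • (e k * d k)) :=
  commute_sum_smul_sub_one b fun k => Commute.sum_right _ _ _ fun k' _ =>
    ((he k k').mul_right (hed k k')).smul_right (b k')

theorem sum_smul_mul_pow_char (p : ℕ) [Fact p.Prime] [CharP R p]
    (he : ∀ k k', Commute (e k) (e k')) (hed : ∀ k k', Commute (e k) (d k'))
    (hd : ∀ k k', Commute (d k) (d k')) (hp : ∀ k, e k ^ p = 1) :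
    (∑ k, b k • (e k * d k)) ^ p = ∑ k, b k ^ p • d k ^ p := by
  rw [sum_pow_char_of_commute p]
  · refine Finset.sum_congr rfl fun k _ => ?_
    rw [smul_pow, (hed k k).mul_pow, hp, one_mul]
  · exact fun k k' => ((((he k k').mul_right (hed k k')).mul_left
      ((hed k' k).symm.mul_right (hd k k'))).smul_left _).smul_right _

end Sums

section Partner

variable {K : Type*} [Field K] {X κ : Type*} [Fintype κ]

/-- The operator `∑ k, b k • s k • c k`. -/
noncomputable def weightedPush (b : κ → K) (s : κ → X → X) (c : κ → List X → K) :
    Module.End K (List X →₀ K) :=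
  ∑ k, b k • ((push K (s k) : Module.End K (List X →₀ K)) * diag (c k))

/-- A partner `y` of the twist operator `t`, satisfying `t y - y t = 1` where the weights do not
degenerate. -/
noncomputable def partner (p : ℕ) (b : κ → K) (s : κ → X → X) (f : List X → K)
    (c : κ → List X → K) : Module.End K (List X →₀ K) :=
  -(weightedPush b s c ^ (p - 1) * diag (fun l => ((∑ k, b k * c k l) ^ p)⁻¹) * diag f)

theorem commute_push_diag (s : X → X) {f : List X → K} (hf : ∀ l, f (l.map s) = f l) :
    Commute (push K s : Module.End K (List X →₀ K)) (diag f) :=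
  push_mul_diag s hf

theorem commute_push_push {s s' : X → X} (h : s ∘ s' = s' ∘ s) :
    Commute (push K s : Module.End K (List X →₀ K)) (push K s') := by
  rw [Commute, SemiconjBy, push_push, push_push, h]

theorem commute_diag_diag (f g : List X → K) : Commute (diag f) (diag g) := by
  rw [Commute, SemiconjBy, diag_mul, diag_mul]
  simp only [mul_comm]

theorem diag_sum (c : κ → List X → K) : diag (fun l => ∑ k, c k l) = ∑ k, diag (c k) :=
  linearMap_ext_list fun l => by simp [diag_single, Finset.sum_smul, LinearMap.sum_apply]

theorem diag_smul (a : K) (f : List X → K) : diag (fun l => a * f l) = a • diag f :=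
  linearMap_ext_list fun l => by simp [diag_single]

variable {b : κ → K} {s : κ → X → X} {c : κ → List X → K}

theorem weightedPush_pow_char (p : ℕ) [Fact p.Prime] [CharP K p]
    (hcomm : ∀ k k', s k ∘ s k' = s k' ∘ s k) (hs : ∀ k, (s k)^[p] = id)
    (hc : ∀ k k' l, c k (l.map (s k')) = c k l) :
    weightedPush b s c ^ p = diag fun l => (∑ k, b k * c k l) ^ p := by
  have := charP_end (X := X) (K := K) p
  have h2 : (fun l => (∑ k, b k * c k l) ^ p) = fun l => ∑ k, b k ^ p * c k l ^ p := by
    funext l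
    rw [sum_pow_char_of_commute p _ _ fun _ _ => Commute.all _ _]
    simp only [mul_pow]
  rw [h2, diag_sum]
  refine (sum_smul_mul_pow_char (R := Module.End K (List X →₀ K)) b p
    (fun k k' => commute_push_push (hcomm k k')) (fun k k' => commute_push_diag _ (hc k' k))
    (fun _ _ => commute_diag_diag _ _) fun k => ?_).trans
    (Finset.sum_congr rfl fun k _ => ?_)
  · rw [push_pow, hs, push_id]
  · rw [diag_pow, diag_smul]

theorem twist_partner (p : ℕ) [hp : Fact p.Prime] [CharP K p]
    (hcomm : ∀ k k', s k ∘ s k' = s k' ∘ s k) (hs : ∀ k, (s k)^[p] = id)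
    (hc : ∀ k k' l, c k (l.map (s k')) = c k l) {f : List X → K}
    (hf : ∀ k l, f (l.map (s k)) = f l + c k l) {P : List X → Prop}
    (hP : ∀ l, P l → ∑ k, b k * c k l ≠ 0) {n : ℕ} {z : List X →₀ K} (hz : z ∈ chains K P n) :
    twist b s (partner p b s f c z) = partner p b s f c (twist b s z) + z := by
  set e : List X → K := fun l => ((∑ k, b k * c k l) ^ p)⁻¹ with he
  have hes : ∀ k l, e (l.map (s k)) = e l := by
    intro k l
    simp only [he, hc]
  have htu : Commute (twist b s) (weightedPush b s c) :=
    commute_sum_sum (R := Module.End K (List X →₀ K)) b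
      (fun k k' => commute_push_push (hcomm k k')) fun k k' => commute_push_diag _ (hc k' k)
  have hte : Commute (twist b s) (diag e) :=
    commute_sum_smul_sub_one (R := Module.End K (List X →₀ K)) b
      fun k => commute_push_diag _ (hes k)
  have hue : Commute (weightedPush b s c) (diag e) :=
    commute_sum_smul_mul (R := Module.End K (List X →₀ K)) b
      (fun k => commute_push_diag _ (hes k)) fun _ => commute_diag_diag _ _
  have hta : twist b s * diag f = diag f * twist b s - weightedPush b s c :=
    linearMap_ext_list fun l => by
      simp only [twist, weightedPush, Module.End.mul_apply, LinearMap.sub_apply,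
        LinearMap.sum_apply, LinearMap.smul_apply, diag_single, map_sum, map_smul, map_sub,
        push_single, Module.End.one_apply, hf, ← Finset.sum_sub_distrib, Finset.smul_sum]
      refine Finset.sum_congr rfl fun k _ => ?_
      module
  have key := weyl_partner (R := Module.End K (List X →₀ K)) (n := p - 1) htu hte hue hta
  rw [Nat.sub_add_cancel hp.out.one_le, weightedPush_pow_char p hcomm hs hc, diag_mul] at key
  have hz1 : diag (fun l => (∑ k, b k * c k l) ^ p * e l) z = z := by
    have := map_mem_of_mem_chains (N := ⊥) (diag (fun l => (∑ k, b k * c k l) ^ p * e l) - 1)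
      (fun l _ hl => by simp [diag_single, he, hP l hl]) hz
    exact sub_eq_zero.1 (by simpa using this)
  have := LinearMap.congr_fun key z
  rwa [LinearMap.add_apply, hz1] at this

theorem diag_mem_chains (f : List X → K) {P : List X → Prop} {n : ℕ} {z : List X →₀ K}
    (hz : z ∈ chains K P n) : diag f z ∈ chains K P n :=
  map_mem_of_mem_chains _ (fun l hl hP => by
    rw [diag_single]
    exact Submodule.smul_mem _ _ (single_mem_chains hl hP 1)) hz

/-- A subspace stable under shifts and diagonal operators with symmetric weights is stable under the
partner operator. -/
theorem partner_mem {D : Submodule K (List X →₀ K)} (p : ℕ) {f : List X → K}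
    (hs : ∀ k, ∀ z ∈ D, push K (s k) z ∈ D) (hf : ∀ z ∈ D, diag f z ∈ D)
    (hc : ∀ k, ∀ z ∈ D, diag (c k) z ∈ D)
    (hθ : ∀ z ∈ D, diag (fun l => ((∑ k, b k * c k l) ^ p)⁻¹) z ∈ D) {z : List X →₀ K}
    (hz : z ∈ D) : partner p b s f c z ∈ D := by
  have hu : ∀ z ∈ D, weightedPush b s c z ∈ D := by
    intro z hz
    rw [weightedPush, LinearMap.sum_apply]
    exact D.sum_mem fun k _ => D.smul_mem _ (hs k _ (hc k _ hz))
  have hun : ∀ n, ∀ z ∈ D, (weightedPush b s c ^ n) z ∈ D := by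
    intro n
    induction n with
    | zero => exact fun z hz => hz
    | succ n ih =>
      intro z hz
      rw [pow_succ, Module.End.mul_apply]
      exact ih _ (hu z hz)
  exact D.neg_mem (hun _ _ (hθ _ (hf _ hz)))

end Partner

/-! ### Alternating chains -/

section Degenerate

variable (K X : Type*) [Field K]

/-- The chains that vanish in the alternating complex. -/
noncomputable def degenerate : Submodule K (List X →₀ K) :=
  Submodule.span K
    ({z | ∃ l₁ a l₂, z = Finsupp.single (l₁ ++ a :: a :: l₂) 1} ∪
      {z | ∃ l₁ a b l₂, z = Finsupp.single (l₁ ++ a :: b :: l₂) 1 +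
        Finsupp.single (l₁ ++ b :: a :: l₂) 1})

variable {K X}

theorem single_repeat_mem (l₁ : List X) (a : X) (l₂ : List X) :
    Finsupp.single (l₁ ++ a :: a :: l₂) (1 : K) ∈ degenerate K X :=
  Submodule.subset_span (Or.inl ⟨l₁, a, l₂, rfl⟩)

theorem single_swap_mem (l₁ : List X) (a b : X) (l₂ : List X) :
    Finsupp.single (l₁ ++ a :: b :: l₂) (1 : K) + Finsupp.single (l₁ ++ b :: a :: l₂) 1 ∈
      degenerate K X :=
  Submodule.subset_span (Or.inr ⟨l₁, a, b, l₂, rfl⟩)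

theorem map_mem_of_mem_degenerate {M : Type*} [AddCommGroup M] [Module K M]
    (A : (List X →₀ K) →ₗ[K] M) {N : Submodule K M}
    (h₁ : ∀ l₁ a l₂, A (Finsupp.single (l₁ ++ a :: a :: l₂) 1) ∈ N)
    (h₂ : ∀ l₁ a b l₂, A (Finsupp.single (l₁ ++ a :: b :: l₂) 1) +
      A (Finsupp.single (l₁ ++ b :: a :: l₂) 1) ∈ N) {z : List X →₀ K}
    (hz : z ∈ degenerate K X) : A z ∈ N := by
  suffices h : degenerate K X ≤ N.comap A from h hz
  refine Submodule.span_le.2 ?_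
  rintro _ (⟨l₁, a, l₂, rfl⟩ | ⟨l₁, a, b, l₂, rfl⟩)
  · exact h₁ l₁ a l₂
  · rw [SetLike.mem_coe, Submodule.mem_comap, map_add]
    exact h₂ l₁ a b l₂

theorem cons_mem_degenerate (x : X) {z : List X →₀ K} (hz : z ∈ degenerate K X) :
    cons K x z ∈ degenerate K X :=
  map_mem_of_mem_degenerate _
    (fun l₁ a l₂ => by simpa using single_repeat_mem (x :: l₁) a l₂)
    (fun l₁ a b l₂ => by simpa using single_swap_mem (x :: l₁) a b l₂) hz

theorem push_mem_degenerate {Y : Type*} (f : X → Y) {z : List X →₀ K} (hz : z ∈ degenerate K X) :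
    push K f z ∈ degenerate K Y :=
  map_mem_of_mem_degenerate _
    (fun l₁ a l₂ => by simpa using single_repeat_mem (l₁.map f) (f a) (l₂.map f))
    (fun l₁ a b l₂ => by simpa using single_swap_mem (l₁.map f) (f a) (f b) (l₂.map f)) hz

theorem diag_mem_degenerate [DecidableEq X] (f : Finset X → K) {z : List X →₀ K}
    (hz : z ∈ degenerate K X) : diag (fun l => f l.toFinset) z ∈ degenerate K X := by
  refine map_mem_of_mem_degenerate _ (fun l₁ a l₂ => ?_) (fun l₁ a b l₂ => ?_) hz
  · rw [diag_single]
    exact Submodule.smul_mem _ _ (single_repeat_mem l₁ a l₂)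
  · have : (l₁ ++ b :: a :: l₂).toFinset = (l₁ ++ a :: b :: l₂).toFinset :=
      List.toFinset_eq_of_perm _ _ ((List.Perm.swap a b l₂).append_left l₁)
    rw [diag_single, diag_single, this, ← smul_add]
    exact Submodule.smul_mem _ _ (single_swap_mem l₁ a b l₂)

theorem cons_cons_self_mem (a : X) (z : List X →₀ K) : cons K a (cons K a z) ∈ degenerate K X := by
  induction z using Finsupp.induction_linear with
  | zero => simp
  | add z w hz hw => simpa using Submodule.add_mem _ hz hw
  | single l c =>
    rw [← mul_one c, ← smul_eq_mul, ← Finsupp.smul_single, map_smul, map_smul, cons_single,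
      cons_single]
    exact Submodule.smul_mem _ _ (single_repeat_mem [] a l)

theorem cons_cons_swap_mem (a b : X) (z : List X →₀ K) :
    cons K a (cons K b z) + cons K b (cons K a z) ∈ degenerate K X := by
  induction z using Finsupp.induction_linear with
  | zero => simp
  | add z w hz hw =>
    have := Submodule.add_mem _ hz hw
    simp only [map_add]
    convert this using 1
    abel
  | single l c =>
    rw [← mul_one c, ← smul_eq_mul, ← Finsupp.smul_single]
    simp only [map_smul, cons_single, ← smul_add]
    exact Submodule.smul_mem _ _ (single_swap_mem [] a b l)

theorem bd_mem_degenerate {z : List X →₀ K} (hz : z ∈ degenerate K X) :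
    bd K z ∈ degenerate K X := by
  refine map_mem_of_mem_degenerate _ (fun l₁ a l₂ => ?_) (fun l₁ a b l₂ => ?_) hz
  · rw [bd_single]
    induction l₁ with
    | nil =>
      have : bdList K (a :: a :: l₂) = cons K a (cons K a (bdList K l₂)) := by
        simp [bdList]
      exact this ▸ cons_cons_self_mem a _
    | cons x l₁ ih =>
      exact Submodule.sub_mem _ (single_repeat_mem l₁ a l₂) (cons_mem_degenerate x ih)
  · rw [bd_single, bd_single]
    induction l₁ with
    | nil =>
      have : bdList K (a :: b :: l₂) + bdList K (b :: a :: l₂) =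
          cons K a (cons K b (bdList K l₂)) + cons K b (cons K a (bdList K l₂)) := by
        simp only [bdList, map_sub, cons_single]
        abel
      exact this ▸ cons_cons_swap_mem a b _
    | cons x l₁ ih =>
      have := Submodule.sub_mem _ (single_swap_mem (K := K) l₁ a b l₂) (cons_mem_degenerate x ih)
      rw [map_add, add_sub_add_comm] at this
      exact this

theorem single_mem_degenerate {l : List X} (hl : ¬ l.Nodup) :
    Finsupp.single l (1 : K) ∈ degenerate K X := by
  induction l with
  | nil => simp at hl
  | cons x l ih =>
    by_cases hx : x ∈ l
    · obtain ⟨s, t, rfl⟩ := List.append_of_mem hx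
      clear ih hl hx
      induction s with
      | nil => exact single_repeat_mem [] x t
      | cons y s ih =>
        have h1 := single_swap_mem (K := K) [] x y (s ++ x :: t)
        have h2 := cons_mem_degenerate y ih
        rw [cons_single] at h2
        simpa using Submodule.sub_mem _ h1 h2
    · have := cons_mem_degenerate x (ih fun h => hl (List.nodup_cons.2 ⟨hx, h⟩))
      rwa [cons_single] at this

theorem single_nil_notMem_degenerate : Finsupp.single [] (1 : K) ∉ degenerate K X := by
  intro h
  have := map_mem_of_mem_degenerate (N := ⊥) (Finsupp.lapply ([] : List X))
    (fun l₁ a l₂ => by simp) (fun l₁ a b l₂ => by simp) h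
  simp at this

end Degenerate

/-- Orbitwise additive cocycles: a function that changes along the action by an orbit-invariant
linear functional, nonzero on the points that are not fixed. -/
theorem exists_cocycle (p : ℕ) [Fact p.Prime] {F Y : Type*} [AddCommGroup F] [Module (ZMod p) F]
    (act : F → Y → Y) (h0 : ∀ y, act 0 y = y) (hadd : ∀ g h y, act (g + h) y = act g (act h y)) :
    ∃ (f : Y → ZMod p) (χ : Y → F →ₗ[ZMod p] ZMod p),
      (∀ g y, f (act g y) = f y + χ y g) ∧ (∀ g y, χ (act g y) = χ y) ∧
      ∀ y, (∃ g, act g y ≠ y) → χ y ≠ 0 := by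
  have hneg : ∀ g y, act (-g) (act g y) = y := fun g y => by rw [← hadd, neg_add_cancel, h0]
  let r : Setoid Y :=
    { r := fun y z => ∃ g, act g y = z
      iseqv := ⟨fun y => ⟨0, h0 y⟩, fun ⟨g, hg⟩ => ⟨-g, by rw [← hg, hneg]⟩,
        fun ⟨g, hg⟩ ⟨h, hh⟩ => ⟨h + g, by rw [hadd, hg, hh]⟩⟩ }
  let stab : Y → Submodule (ZMod p) F := fun y => AddSubgroup.toZModSubmodule p
    { carrier := {g | act g y = y}
      add_mem' := fun {a b} ha hb => by
        rw [Set.mem_ofPred_eq] at ha hb ⊢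
        rw [hadd, hb, ha]
      zero_mem' := h0 y
      neg_mem' := fun {a} ha => by
        rw [Set.mem_ofPred_eq] at ha ⊢
        nth_rewrite 1 [← ha]
        exact hneg a y }
  have mem_stab : ∀ g y, g ∈ stab y ↔ act g y = y := fun g y => Iff.rfl
  have hfun : ∀ y, ∃ χ : F →ₗ[ZMod p] ZMod p, (∀ g, act g y = y → χ g = 0) ∧
      ((∃ g, act g y ≠ y) → χ ≠ 0) := by
    intro y
    by_cases hy : ∃ g, act g y ≠ y
    · have : stab y < ⊤ := by
        rw [lt_top_iff_ne_top]
        intro h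
        obtain ⟨g, hg⟩ := hy
        exact hg ((mem_stab g y).1 (h ▸ Submodule.mem_top))
      obtain ⟨χ, hχ, hle⟩ := Submodule.exists_le_ker_of_lt_top _ this
      exact ⟨χ, fun g hg => hle ((mem_stab g y).2 hg), fun _ => hχ⟩
    · exact ⟨0, fun _ _ => rfl, fun h => absurd h hy⟩
  choose χ hχ0 hχ using hfun
  let rep : Y → Y := fun y => (Quotient.mk r y).out
  have hrep : ∀ y, ∃ g, act g (rep y) = y := fun y => Quotient.mk_out (s := r) y
  choose γ hγ using hrep
  have hrep_act : ∀ g y, rep (act g y) = rep y := fun g y =>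
    congrArg Quotient.out (Quotient.sound (s := r) ⟨-g, hneg g y⟩)
  refine ⟨fun y => χ (rep y) (γ y), fun y => χ (rep y), fun g y => ?_, fun g y => ?_,
    fun y hy => ?_⟩
  · beta_reduce
    rw [hrep_act, ← map_add, ← sub_eq_zero, ← map_sub]
    refine hχ0 _ _ ?_
    have h1 := hγ (act g y)
    rw [hrep_act] at h1
    have h2 : act (γ y + g) (rep y) = act g y := by rw [add_comm, hadd, hγ]
    rw [sub_eq_neg_add, hadd, h1, ← h2, hneg]
  · simp only [hrep_act]
  · refine hχ _ ?_
    by_contra! h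
    obtain ⟨g, hg⟩ := hy
    apply hg
    have h1 := hγ y
    rw [h] at h1
    rw [← h1, h]

/-! ### A descent obstructing equivariant labelings -/

theorem twist_eq_zero_of_mem_chains_zero {K X κ : Type*} [Field K] [Fintype κ] {b : κ → K}
    {s : κ → X → X} {P : List X → Prop} {z : List X →₀ K} (hz : z ∈ chains K P 0) :
    twist b s z = 0 := by
  have := map_mem_of_mem_chains (N := ⊥) (twist b s) (fun l hl _ => by
    rw [List.length_eq_zero_iff] at hl
    subst hl
    simp [twist_nil]) hz
  simpa using this

section Labels

variable {F J : Type*}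

/-- Translation of the first coordinate of a label. -/
def shift [Add F] (g : F) (a : F × J) : F × J := (g + a.1, a.2)

/-- Label lists that miss a color in every row. -/
def MissesColor (l : List (F × J)) : Prop := ∀ j, ∃ i, (i, j) ∉ l

theorem MissesColor.sublist (l l' : List (F × J)) (h : l'.Sublist l) (hl : MissesColor l) :
    MissesColor l' := fun j => (hl j).imp fun _ hi hi' => hi (h.subset hi')

theorem shift_zero [AddZeroClass F] : shift (0 : F) = (id : F × J → F × J) := by
  funext a
  simp [shift]

theorem shift_add [AddSemigroup F] (g h : F) :
    shift (g + h) = (shift g ∘ shift h : F × J → F × J) := by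
  funext a
  simp [shift, add_assoc]

theorem MissesColor.map_shift [AddGroup F] (g : F) (l : List (F × J)) (hl : MissesColor l) :
    MissesColor (l.map (shift g)) := by
  intro j
  obtain ⟨i, hi⟩ := hl j
  refine ⟨g + i, fun h => hi ?_⟩
  obtain ⟨⟨a, a'⟩, ha, haj⟩ := List.mem_map.1 h
  simp only [shift, Prod.mk.injEq, add_right_inj] at haj
  rw [← haj.1, ← haj.2]
  exact ha

theorem MissesColor.not_nodup [Fintype F] [Fintype J] {l : List (F × J)} (hl : MissesColor l)
    (hlen : Fintype.card J * (Fintype.card F - 1) < l.length) : ¬ l.Nodup := by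
  classical
  intro hnd
  choose i hi using hl
  have hsub : l.toFinset ⊆ Finset.univ \ Finset.univ.image fun j => (i j, j) := by
    intro a ha
    simp only [Finset.mem_sdiff, Finset.mem_univ, Finset.mem_image, true_and, not_exists]
    rintro j rfl
    exact hi j (List.mem_toFinset.1 ha)
  have h1 := Finset.card_le_card hsub
  rw [List.toFinset_card_of_nodup hnd, Finset.card_sdiff_of_subset (Finset.subset_univ _),
    Finset.card_image_of_injective _ (fun a b h => (Prod.ext_iff.1 h).2), Finset.card_univ,
    Finset.card_univ, Fintype.card_prod, mul_comm] at h1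
  rw [Nat.mul_sub, mul_one] at hlen
  omega

variable [Field F]

/-- On nonempty label lists missing a color in every row, the kernel of a power of the twist is in
the image of the complementary power, up to degenerate chains. -/
theorem exists_twist_pow (p : ℕ) [Fact p.Prime] [Algebra (ZMod p) F] {κ : Type*} [Fintype κ]
    (b : Module.Basis κ (ZMod p) F) {k n : ℕ} (hk : k < p) {v : List (F × J) →₀ F}
    (hv : v ∈ chains F MissesColor (n + 1))
    (hkv : (twist (b ·) (fun i => shift (b i)) ^ k) v ∈ degenerate F (F × J)) :
    ∃ m ∈ chains F MissesColor (n + 1),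
      v - (twist (b ·) (fun i => shift (b i)) ^ (p - k)) m ∈ degenerate F (F × J) := by
  classical
  have := charP_of_injective_algebraMap (algebraMap (ZMod p) F).injective p
  obtain ⟨f, χ, hf, hχ, hne⟩ := exists_cocycle p
    (fun (g : F) (S : Finset (F × J)) => S.image (shift g))
    (fun S => by rw [shift_zero, Finset.image_id])
    (fun g h S => by rw [shift_add, Finset.image_image])
  set s : κ → F × J → F × J := fun i => shift (b i) with hs
  set fl : List (F × J) → F := fun l => algebraMap (ZMod p) F (f l.toFinset) with hfl
  set c : κ → List (F × J) → F := fun i l => algebraMap (ZMod p) F (χ l.toFinset (b i)) with hc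
  have htoFinset : ∀ i (l : List (F × J)),
      (l.map (s i)).toFinset = l.toFinset.image (shift (b i)) :=
    fun i l => by ext; simp [hs]
  have hs_comm : ∀ i j, s i ∘ s j = s j ∘ s i := fun i j => by
    funext a
    simp [hs, shift, add_left_comm]
  have hs_iter : ∀ i, (s i)^[p] = id := by
    intro i
    have : ∀ n : ℕ, ∀ a, (s i)^[n] a = ((n : F) * b i + a.1, a.2) := by
      intro n
      induction n with
      | zero => simp
      | succ n ih =>
        intro a
        rw [Function.iterate_succ_apply', ih]
        simp only [hs, shift, Prod.mk.injEq, and_true]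
        push_cast
        ring
    funext a
    simp [this]
  have hc_inv : ∀ i j l, c i (l.map (s j)) = c i l := fun i j l => by
    simp only [hc, htoFinset, hχ]
  have hf_add : ∀ i l, fl (l.map (s i)) = fl l + c i l := fun i l => by
    simp only [hfl, hc, htoFinset, hf, map_add]
  have hnondeg : ∀ l : List (F × J), (l.length = n + 1 ∧ MissesColor l) →
      ∑ i, b i * c i l ≠ 0 := by
    rintro l ⟨hlen, hl⟩ h0
    have hz : ∀ i, χ l.toFinset (b i) = 0 := by
      have := Fintype.linearIndependent_iff.1 b.linearIndependent (fun i => χ l.toFinset (b i)) (by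
        rw [← h0]
        exact Finset.sum_congr rfl fun i _ => by rw [Algebra.smul_def, mul_comm])
      exact this
    refine hne l.toFinset ?_ (b.ext fun i => by rw [hz]; rfl)
    obtain ⟨⟨i, j⟩, hij⟩ := List.exists_mem_of_ne_nil l (by rintro rfl; simp at hlen)
    obtain ⟨i', hi'⟩ := hl j
    refine ⟨i' - i, fun h => hi' ?_⟩
    have : shift (i' - i) (i, j) ∈ l.toFinset.image (shift (i' - i)) :=
      Finset.mem_image_of_mem _ (List.mem_toFinset.2 hij)
    rw [h] at this
    simpa [shift] using this
  have hchains : ∀ {z : List (F × J) →₀ F}, z ∈ chains F MissesColor (n + 1) →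
      z ∈ chains F (fun l => l.length = n + 1 ∧ MissesColor l) (n + 1) := by
    intro z hz l hl
    exact ⟨(hz hl).1, hz hl⟩
  have hshift : ∀ i l, MissesColor l → MissesColor (l.map (s i)) := fun i l hl =>
    hl.map_shift (b i) l
  have hpartner : ∀ D : Submodule F (List (F × J) →₀ F),
      (∀ g, ∀ z ∈ D, push F (shift g) z ∈ D) →
      (∀ f : Finset (F × J) → F, ∀ z ∈ D, diag (fun l => f l.toFinset) z ∈ D) →
      ∀ z ∈ D, partner p (b ·) s fl c z ∈ D := fun D h1 h2 z hz =>
    partner_mem p (fun i => h1 (b i)) (h2 fun S => algebraMap (ZMod p) F (f S))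
      (fun i => h2 fun S => algebraMap (ZMod p) F (χ S (b i)))
      (h2 fun S => ((∑ i, b i * algebraMap (ZMod p) F (χ S (b i))) ^ p)⁻¹) hz
  refine exists_pow_of_weyl p (y := partner p (b ·) s fl c)
    (fun v hv => twist_mem_chains _ hshift hv)
    (hpartner _ (fun g z hz => push_mem_chains (fun l hl => hl.map_shift g l) hz)
      fun f z hz => diag_mem_chains _ hz) (fun v hv => ?_)
    (hpartner _ (fun g z hz => push_mem_degenerate _ hz) fun f z hz => diag_mem_degenerate f hz)
    (fun v hv => twist_partner p hs_comm hs_iter hc_inv hf_add hnondeg (hchains hv)) hk hv hkv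
  rw [twist, LinearMap.sum_apply]
  exact Submodule.sum_mem _ fun k _ => Submodule.smul_mem _ _
    (Submodule.sub_mem _ (push_mem_degenerate _ hv) hv)

variable [Fintype F] [Fintype J]

/-- There is no equivariant labeling by `F × J` of a highly acyclic complex of tuples such that the
labels of every tuple miss a color in every row. -/
theorem not_equivariant_labeling (p : ℕ) [hp : Fact p.Prime] [CharP F p] {X : Type*}
    {act : F → X → X} (h0 : ∀ x, act 0 x = x) (hadd : ∀ g h x, act (g + h) x = act g (act h x))
    {P : List X → Prop} (hP : ∀ g l, P l → P (l.map (act g)))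
    {N : ℕ} (hN : N = Fintype.card J * (Fintype.card F - 1) + 1)
    (hexact : ∀ j < N, ∀ z ∈ chains F P j, bd F z = 0 → ∃ w ∈ chains F P (j + 1), bd F w = z)
    {x₀ : X} (hx₀ : P [x₀]) (lam : X → F × J)
    (hlam : ∀ l, P l → ∀ x ∈ l, ∀ g, lam (act g x) = shift g (lam x))
    (hmiss : ∀ l, P l → MissesColor (l.map lam)) : False := by
  classical
  let _ := ZMod.algebra F p
  have : Module.Finite (ZMod p) F := Module.Finite.of_finite
  set b := Module.finBasis (ZMod p) F
  set t := twist (K := F) (b ·) (fun i => act (b i)) with ht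
  set t' := twist (K := F) (b ·) (fun i => shift (J := J) (b i)) with ht'
  have htp : t ^ p = 0 := by
    refine twist_pow_char p _ (fun i j => ?_) fun i => ?_
    · funext x
      simp only [Function.comp_apply, ← hadd, add_comm]
    · have : ∀ n : ℕ, ∀ x, (act (b i))^[n] x = act (n * b i) x := by
        intro n
        induction n with
        | zero => simp [h0]
        | succ n ih =>
          intro x
          rw [Function.iterate_succ_apply', ih, ← hadd]
          congr 1
          push_cast
          ring
      funext x
      simp [this, h0]
  have ht_mem : ∀ {n : ℕ} (m : ℕ) {z}, z ∈ chains F P n → (t ^ m) z ∈ chains F P n :=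
    fun m _ hz => twist_pow_mem_chains _ (fun i => hP (b i)) m hz
  have hpush : ∀ {n : ℕ} (m : ℕ) {z}, z ∈ chains F P n →
      push F lam ((t ^ m) z) = (t' ^ m) (push F lam z) := fun m _ hz =>
    push_twist_pow _ (fun i => hP (b i)) (fun l hl x hx i => hlam l hl x hx (b i)) m hz
  have hD : ∀ m, ∀ z ∈ degenerate F (F × J), (t' ^ m) z ∈ degenerate F (F × J) := by
    intro m
    induction m with
    | zero => exact fun z hz => hz
    | succ m ih =>
      intro z hz
      rw [pow_succ, Module.End.mul_apply]
      refine ih _ ?_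
      rw [ht', twist, LinearMap.sum_apply]
      exact Submodule.sum_mem _ fun k _ => Submodule.smul_mem _ _
        (Submodule.sub_mem _ (push_mem_degenerate _ hz) hz)
  have hp2 := hp.out.two_le
  let e : ℕ → ℕ := fun j => if Even j then p - 1 else 1
  have he : ∀ j, e j + e (j + 1) = p := by
    intro j
    by_cases hj : Even j
    · simp [e, hj, Nat.even_add_one]; omega
    · simp [e, hj, Nat.even_add_one]; omega
  have he_lt : ∀ j, e j < p := by
    intro j
    simp only [e]
    split_ifs <;> omega
  have descent : ∀ i j, j + 1 + i = N → ∀ y ∈ chains F P (j + 1), bd F ((t ^ e (j + 1)) y) = 0 →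
      ∃ m ∈ chains F MissesColor (j + 1), ∃ w ∈ chains F MissesColor (j + 2),
        push F lam y - bd F w - (t' ^ (p - e (j + 1))) m ∈ degenerate F (F × J) := by
    intro i
    induction i with
    | zero =>
      intro j hj y hy _
      refine ⟨0, Submodule.zero_mem _, 0, Submodule.zero_mem _, ?_⟩
      rw [map_zero, map_zero, sub_zero, sub_zero]
      refine map_mem_of_mem_chains (push F lam) (fun l hl hPl => ?_) hy
      rw [push_single]
      exact single_mem_degenerate ((hmiss l hPl).not_nodup (by rw [List.length_map]; omega))
    | succ i ih =>
      intro j hj y hy hbd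
      obtain ⟨y', hy', hby'⟩ := hexact (j + 1) (by omega) _ (ht_mem _ hy) hbd
      obtain ⟨m, hm, w, hw, hmw⟩ := ih (j + 1) (by omega) y' hy' (by
        rw [ht, bd_twist_pow, ← ht, hby', ← Module.End.mul_apply, ← pow_add, add_comm, he, htp]
        rfl)
      have hv : push F lam y - bd F m ∈ chains F MissesColor (j + 1) :=
        Submodule.sub_mem _ (push_mem_chains hmiss hy) (bd_mem_chains MissesColor.sublist hm)
      obtain ⟨m', hm', hmm'⟩ := exists_twist_pow p b (he_lt (j + 1)) hv (by
        have h1 := bd_mem_degenerate hmw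
        rw [map_sub, map_sub, bd_bd, sub_zero, bd_push, hby', hpush _ hy, ht', bd_twist_pow,
          show p - e (j + 1 + 1) = e (j + 1) by have := he (j + 1); omega, ← map_sub] at h1
        exact h1)
      exact ⟨m', hm', m, hm, hmm'⟩
  obtain ⟨m, hm, w, -, hmw⟩ := descent (N - 1) 0 (by omega) (Finsupp.single [x₀] 1)
    (single_mem_chains rfl hx₀ 1) (by
      rw [ht, bd_twist_pow]
      simp [e, bdList, twist_nil])
  have h1 := bd_mem_degenerate hmw
  rw [map_sub, map_sub, bd_bd, sub_zero, ht', bd_twist_pow] at h1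
  have h2 : (t' ^ (p - e (0 + 1))) (bd F m) = 0 := by
    have hlt := he_lt (0 + 1)
    rw [show p - e (0 + 1) = (p - e (0 + 1) - 1) + 1 by omega, pow_succ, Module.End.mul_apply, ht',
      twist_eq_zero_of_mem_chains_zero (bd_mem_chains MissesColor.sublist hm), map_zero]
  rw [← ht', h2, sub_zero] at h1
  refine single_nil_notMem_degenerate (K := F) (X := F × J) ?_
  simpa [bdList] using h1

end Labels

/-! ### The test map -/

/-- A partial proper coloring extends greedily when every degree is below the number of colors. -/
theorem exists_coloring_extension {V F : Type*} [Fintype V] [Fintype F] (G : SimpleGraph V)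
    [DecidableRel G.Adj] (hdeg : ∀ v, G.degree v < Fintype.card F) (T : Set V) (c₀ : V → F)
    (hc₀ : ∀ u ∈ T, ∀ w ∈ T, G.Adj u w → c₀ u ≠ c₀ w) :
    ∃ c : V → F, (∀ v ∈ T, c v = c₀ v) ∧ ∀ u w, G.Adj u w → c u ≠ c w := by
  classical
  suffices h : ∀ S : Finset V, ∃ c : V → F, (∀ v ∈ T, c v = c₀ v) ∧
      ∀ u w, (u ∈ T ∨ u ∈ S) → (w ∈ T ∨ w ∈ S) → G.Adj u w → c u ≠ c w by
    obtain ⟨c, h1, h2⟩ := h Finset.univ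
    exact ⟨c, h1, fun u w => h2 u w (Or.inr (Finset.mem_univ u)) (Or.inr (Finset.mem_univ w))⟩
  intro S
  induction S using Finset.induction_on with
  | empty =>
    refine ⟨c₀, fun _ _ => rfl, fun u w hu hw => hc₀ u ?_ w ?_⟩
    · simpa using hu
    · simpa using hw
  | insert a S _ ih =>
    obtain ⟨c, h1, h2⟩ := ih
    by_cases haT : a ∈ T
    · refine ⟨c, h1, fun u w hu hw => h2 u w ?_ ?_⟩
      · rw [Finset.mem_insert] at hu
        rcases hu with hu | rfl | hu
        exacts [Or.inl hu, Or.inl haT, Or.inr hu]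
      · rw [Finset.mem_insert] at hw
        rcases hw with hw | rfl | hw
        exacts [Or.inl hw, Or.inl haT, Or.inr hw]
    · have hlt : ((G.neighborFinset a).image c).card < (Finset.univ : Finset F).card :=
        Finset.card_image_le.trans_lt (by rw [G.card_neighborFinset_eq_degree]; exact hdeg a)
      obtain ⟨i, -, hi⟩ := Finset.exists_mem_notMem_of_card_lt_card hlt
      have hi' : ∀ w, G.Adj a w → c w ≠ i := fun w hw h =>
        hi (Finset.mem_image.2 ⟨w, (G.mem_neighborFinset a w).2 hw, h⟩)
      refine ⟨Function.update c a i, fun v hv => ?_, fun u w hu hw huw => ?_⟩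
      · rw [Function.update_of_ne (by rintro rfl; exact haT hv), h1 v hv]
      · rcases eq_or_ne u a with rfl | hua
        · rw [Function.update_self, Function.update_of_ne huw.ne']
          exact (hi' w huw).symm
        · rcases eq_or_ne w a with rfl | hwa
          · rw [Function.update_self, Function.update_of_ne hua]
            exact hi' u huw.symm
          · rw [Function.update_of_ne hua, Function.update_of_ne hwa]
            refine h2 u w ?_ ?_ huw
            · simpa [hua] using hu
            · simpa [hwa] using hw

section Recolor

variable {V F : Type*}

/-- Translation of colors. -/
def recolor [Sub F] (g : F) (x : V × F → ℝ) : V × F → ℝ := fun a => x (a.1, a.2 - g)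

variable [AddCommGroup F]

theorem recolor_zero (x : V × F → ℝ) : recolor 0 x = x := by
  funext a
  simp [recolor]

theorem recolor_add (g h : F) (x : V × F → ℝ) : recolor (g + h) x = recolor g (recolor h x) := by
  funext a
  simp [recolor, sub_add_eq_sub_sub]

theorem recolor_add_apply (g : F) (x : V × F → ℝ) (v : V) (i : F) :
    recolor g x (v, g + i) = x (v, i) := by
  simp [recolor]

theorem conflict_sub {G : SimpleGraph V} {a b : V × F} (g : F) (h : Conflict G F a b) :
    Conflict G F (a.1, a.2 - g) (b.1, b.2 - g) := by
  simpa [Conflict] using h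

end Recolor

section Points

variable {V F : Type*} [Fintype V] [Fintype F] (G : SimpleGraph V)

variable (F) in
/-- The points of the geometric realization of the complex of partial proper colorings. -/
def coloringPoints : Set (V × F → ℝ) :=
  {x | x ∈ stdSimplex ℝ (V × F) ∧ ∀ a b, x a ≠ 0 → x b ≠ 0 → ¬ Conflict G F a b}

theorem isCompact_coloringPoints : IsCompact (coloringPoints F G) := by
  have : coloringPoints F G = stdSimplex ℝ (V × F) ∩
      ⋂ (a) (b) (_ : Conflict G F a b), {x | x a * x b = 0} := by
    ext x
    simp only [coloringPoints, Set.mem_ofPred_eq, Set.mem_inter_iff, Set.mem_iInter, mul_eq_zero]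
    refine and_congr_right fun _ => forall_congr' fun a => forall_congr' fun b => ?_
    tauto
  rw [this]
  refine (isCompact_stdSimplex ℝ _).inter_right ?_
  exact isClosed_iInter fun a => isClosed_iInter fun b => isClosed_iInter fun _ =>
    isClosed_eq (by fun_prop) continuous_const

variable {G}

theorem SmallTuple.mem_coloringPoints {ε : ℝ} {l : List (V × F → ℝ)}
    (hl : SmallTuple (Conflict G F) ε Set.univ l) {x : V × F → ℝ} (hx : x ∈ l) :
    x ∈ coloringPoints F G :=
  ⟨(hl x hx x hx).1, (hl x hx x hx).2.2.1⟩

variable [AddCommGroup F]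

theorem recolor_mem_coloringPoints (g : F) {x : V × F → ℝ} (hx : x ∈ coloringPoints F G) :
    recolor g x ∈ coloringPoints F G := by
  refine ⟨⟨fun a => hx.1.1 _, ?_⟩, fun a b ha hb h => hx.2 _ _ ha hb (conflict_sub g h)⟩
  rw [← hx.1.2]
  exact ((Equiv.refl V).prodCongr (Equiv.subRight g)).sum_comp x

theorem SmallTuple.map_recolor {ε : ℝ} (g : F) (l : List (V × F → ℝ))
    (hl : SmallTuple (Conflict G F) ε Set.univ l) :
    SmallTuple (Conflict G F) ε Set.univ (l.map (recolor g)) := by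
  intro x' hx' y' hy'
  obtain ⟨x, hx, rfl⟩ := List.mem_map.1 hx'
  obtain ⟨y, hy, rfl⟩ := List.mem_map.1 hy'
  obtain ⟨-, -, h3, h4⟩ := hl x hx y hy
  refine ⟨(recolor_mem_coloringPoints g (hl.mem_coloringPoints hx)).1, fun _ _ => Set.mem_univ _,
    fun a b ha hb h => h3 _ _ ha hb (conflict_sub g h), lt_of_le_of_lt ?_ h4⟩
  exact (dist_pi_le_iff dist_nonneg).2 fun a => dist_le_pi_dist x y _

/-- A family of functions indexed by labels that is equivariant, balanced and somewhere positive on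
the points of the complex of partial colorings yields an equivariant labeling. -/
theorem exists_equivariant_labeling {J : Type*} [Fintype J] [Nonempty J]
    (dev : (V × F → ℝ) → F × J → ℝ) (hcont : Continuous dev)
    (hequiv : ∀ g x a, dev (recolor g x) (shift g a) = dev x a)
    (hsum : ∀ x j, ∑ i, dev x (i, j) = 0)
    (hpos : ∀ x ∈ coloringPoints F G, ∃ a, 0 < dev x a) :
    ∃ ε > 0, ∃ lam : (V × F → ℝ) → F × J,
      (∀ x ∈ coloringPoints F G, ∀ g, lam (recolor g x) = shift g (lam x)) ∧
      ∀ l, SmallTuple (Conflict G F) ε Set.univ l → MissesColor (l.map lam) := by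
  classical
  have hδ : ∃ δ > 0, ∀ x ∈ coloringPoints F G, ∃ a, δ ≤ dev x a := by
    rcases (coloringPoints F G).eq_empty_or_nonempty with hK | hK
    · exact ⟨1, one_pos, by simp [hK]⟩
    · have hM : Continuous fun x => Finset.univ.sup' Finset.univ_nonempty (dev x) :=
        Continuous.finset_sup'_apply _ fun a _ => (continuous_apply a).comp hcont
      obtain ⟨x₀, hx₀, hmin⟩ := (isCompact_coloringPoints G).exists_isMinOn hK hM.continuousOn
      obtain ⟨a₀, ha₀⟩ := hpos x₀ hx₀
      refine ⟨_, ha₀.trans_le (Finset.le_sup' (dev x₀) (Finset.mem_univ a₀)), fun x hx => ?_⟩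
      obtain ⟨a, -, ha⟩ := Finset.exists_mem_eq_sup' Finset.univ_nonempty (dev x)
      exact ⟨a, (hmin hx).trans_eq ha⟩
  obtain ⟨δ, hδ0, hδ⟩ := hδ
  obtain ⟨ε, hε, hunif⟩ := Metric.uniformContinuousOn_iff.1
    ((isCompact_coloringPoints (F := F) G).uniformContinuousOn_of_continuous hcont.continuousOn)
    δ hδ0
  rcases isEmpty_or_nonempty V with hV | hV
  · refine ⟨ε, hε, fun _ => Classical.arbitrary _, fun x hx => ?_, fun l hl => ?_⟩
    · have := hx.1.2
      simp at this
    · rcases l with _ | ⟨x, l⟩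
      · exact fun j => ⟨0, by simp⟩
      · have := (hl x (by simp) x (by simp)).1.2
        simp at this
  let vert : (V × F → ℝ) → V := fun x => Classical.epsilon fun v => ∃ i, x (v, i) ≠ 0
  let col : (V × F → ℝ) → F := fun x => Classical.epsilon fun i => x (vert x, i) ≠ 0
  let base : (V × F → ℝ) → F × J := fun x => Classical.epsilon fun a => δ ≤ dev x a
  have hcol : ∀ x ∈ coloringPoints F G, x (vert x, col x) ≠ 0 := by
    intro x hx
    have h1 : ∃ v, ∃ i, x (v, i) ≠ 0 := by
      by_contra! h
      have := hx.1.2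
      rw [Finset.sum_eq_zero fun a _ => h a.1 a.2] at this
      exact zero_ne_one this
    exact Classical.epsilon_spec (Classical.epsilon_spec h1)
  have hvert : ∀ g x, vert (recolor g x) = vert x := by
    intro g x
    refine congrArg Classical.epsilon (funext fun v => propext ⟨?_, ?_⟩)
    · rintro ⟨i, hi⟩
      exact ⟨i - g, hi⟩
    · rintro ⟨i, hi⟩
      exact ⟨g + i, by rwa [recolor_add_apply]⟩
  have hcol_recolor : ∀ x ∈ coloringPoints F G, ∀ g, col (recolor g x) = g + col x := by
    intro x hx g
    have h1 := hcol _ (recolor_mem_coloringPoints g hx)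
    rw [hvert] at h1
    have h2 := hcol x hx
    by_contra hne
    refine hx.2 _ _ h1 h2 (Or.inl ⟨rfl, fun h => hne ?_⟩)
    exact (sub_eq_iff_eq_add'.1 h)
  have hbase : ∀ x ∈ coloringPoints F G, δ ≤ dev x (base x) := fun x hx =>
    Classical.epsilon_spec (hδ x hx)
  let lam : (V × F → ℝ) → F × J := fun x => shift (col x) (base (recolor (-col x) x))
  have hlam : ∀ x ∈ coloringPoints F G, δ ≤ dev x (lam x) := by
    intro x hx
    have h1 := hbase _ (recolor_mem_coloringPoints (-col x) hx)
    rwa [← hequiv (col x), ← recolor_add, add_neg_cancel, recolor_zero] at h1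
  refine ⟨ε, hε, lam, fun x hx g => ?_, fun l hl j => ?_⟩
  · simp only [lam]
    rw [hcol_recolor x hx, ← recolor_add, shift_add, Function.comp_apply, neg_add_rev,
      neg_add_cancel_right]
  · by_contra! h
    obtain ⟨y, hy, -⟩ := List.mem_map.1 (h 0)
    have hpos : ∀ i, 0 < dev y (i, j) := by
      intro i
      obtain ⟨x, hx, hxi⟩ := List.mem_map.1 (h i)
      have hxK := hl.mem_coloringPoints hx
      have h1 := hlam x hxK
      rw [hxi] at h1
      have h2 := (dist_le_pi_dist (dev x) (dev y) (i, j)).trans_lt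
        (hunif x hxK y (hl.mem_coloringPoints hy) (hl x hx y hy).2.2.2)
      rw [Real.dist_eq, abs_lt] at h2
      linarith [h2.2]
    exact (Finset.sum_pos (fun i _ => hpos i) Finset.univ_nonempty).ne' (hsum y j)

end Points

/-! ### Equalizing points and colorings -/

/-- Under the degree bound, a continuous equivariant family of functions on the complex of partial
colorings takes, at some point, values that do not depend on the color. -/
theorem exists_equalizing_point {V F J : Type*} [Fintype V] [Field F] [Fintype F] [Fintype J]
    [Nonempty J] (p : ℕ) [Fact p.Prime] [CharP F p] (G : SimpleGraph V) [DecidableRel G.Adj]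
    (hcard : Fintype.card V = Fintype.card J * (Fintype.card F - 1) + 1)
    (hdeg : ∀ v : V, ({u : V | G.dist v u = 2} : Set V).ncard + 2 * G.degree v < Fintype.card F)
    (Φ : (V × F → ℝ) → F × J → ℝ) (hcont : Continuous Φ)
    (hequiv : ∀ g x a, Φ (recolor g x) (shift g a) = Φ x a) :
    ∃ x ∈ coloringPoints F G, ∀ i i' j, Φ x (i, j) = Φ x (i', j) := by
  classical
  by_contra! hne
  let dev : (V × F → ℝ) → F × J → ℝ := fun x a =>
    Φ x a - (Fintype.card F : ℝ)⁻¹ * ∑ i, Φ x (i, a.2)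
  have hsum : ∀ x j, ∑ i, dev x (i, j) = 0 := fun x j => by
    simp [dev, Finset.sum_sub_distrib]
  obtain ⟨ε, hε, lam, hlam, hmiss⟩ := exists_equivariant_labeling (G := G) dev
    (continuous_pi fun a => ((continuous_apply a).comp hcont).sub
      (continuous_const.mul (continuous_finsetSum _ fun i _ => (continuous_apply _).comp hcont)))
    (fun g x a => by
      have h : ∑ i, Φ (recolor g x) (i, a.2) = ∑ i, Φ x (i, a.2) := by
        rw [← Equiv.sum_comp (Equiv.addLeft g)]
        exact Finset.sum_congr rfl fun i _ => hequiv g x (i, a.2)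
      change Φ (recolor g x) (shift g a) - _ * ∑ i, Φ (recolor g x) (i, a.2) = _
      rw [h, hequiv]) hsum
    (fun x hx => by
      by_contra! hle
      obtain ⟨i, i', j, hij⟩ := hne x hx
      have h0 := (Finset.sum_eq_zero_iff_of_nonpos fun i _ => hle (i, j)).1 (hsum x j)
      have h1 := h0 i (Finset.mem_univ i)
      have h2 := h0 i' (Finset.mem_univ i')
      simp only [dev] at h1 h2
      exact hij (by linarith))
  have hV : Nonempty V := Fintype.card_pos_iff.1 (by omega)
  obtain ⟨v₀⟩ := hV
  refine not_equivariant_labeling p (J := J) recolor_zero recolor_add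
    (P := SmallTuple (Conflict G F) ε Set.univ) (fun g l => SmallTuple.map_recolor g l) hcard
    (acyclic_univ hε hdeg) (x₀ := Pi.single (v₀, 0) 1) ?_ lam
    (fun l hl x hx g => hlam x (hl.mem_coloringPoints hx) g) hmiss
  intro x hx y hy
  obtain rfl := List.mem_singleton.1 hx
  obtain rfl := List.mem_singleton.1 hy
  refine ⟨single_mem_stdSimplex ℝ _, fun _ _ => Set.mem_univ _, fun a b ha hb => ?_, by simpa⟩
  obtain rfl : a = (v₀, 0) := by
    by_contra h
    exact ha (Pi.single_eq_of_ne h _)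
  obtain rfl : b = (v₀, 0) := by
    by_contra h
    exact hb (Pi.single_eq_of_ne h _)
  simp [Conflict]

/-- The weights of each color class of a point whose classes have equal weight, rescaled. -/
theorem card_mul_mem_stdSimplex {V F : Type*} [Fintype V] [Fintype F] {x : V × F → ℝ}
    (hx : x ∈ stdSimplex ℝ (V × F)) (h : ∀ i i', ∑ v, x (v, i) = ∑ v, x (v, i')) (i : F) :
    (fun v => (Fintype.card F : ℝ) * x (v, i)) ∈ stdSimplex ℝ V := by
  refine ⟨fun v => mul_nonneg (Nat.cast_nonneg _) (hx.1 _), ?_⟩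
  rw [← Finset.mul_sum, ← nsmul_eq_mul, ← Finset.card_univ, ← Finset.sum_const, ← hx.2,
    Fintype.sum_prod_type_right]
  exact Finset.sum_congr rfl fun i' _ => h i i'

/-- Tverberg's theorem for proper colorings, with a finite field as the set of colors. -/
theorem exists_coloring_of_continuous {V F : Type*} [Fintype V] [Field F] [Fintype F] (p : ℕ)
    [Fact p.Prime] [CharP F p] (G : SimpleGraph V) [DecidableRel G.Adj] (d : ℕ)
    (hcard : Fintype.card V = (d + 1) * (Fintype.card F - 1) + 1)
    (hdeg : ∀ v : V, ({u : V | G.dist v u = 2} : Set V).ncard + 2 * G.degree v < Fintype.card F)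
    (f : stdSimplex ℝ V → EuclideanSpace ℝ (Fin d)) (hf : Continuous f) :
    ∃ c : V → F, (∀ u w, G.Adj u w → c u ≠ c w) ∧
      ∃ y, ∀ i, ∃ z : stdSimplex ℝ V, (∀ v, c v ≠ i → (z : V → ℝ) v = 0) ∧ f z = y := by
  classical
  obtain ⟨g, hg⟩ := ContinuousMap.exists_restrict_eq (isClosed_stdSimplex ℝ V)
    (⟨fun z => (f z).ofLp, (PiLp.continuous_ofLp 2 _).comp hf⟩ : C(stdSimplex ℝ V, Fin d → ℝ))
  have hgf : ∀ z : stdSimplex ℝ V, g z = (f z).ofLp := fun z => DFunLike.congr_fun hg z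
  let Φ : (V × F → ℝ) → F × Option (Fin d) → ℝ := fun x a =>
    a.2.elim (∑ v, x (v, a.1)) (g fun v => (Fintype.card F : ℝ) * x (v, a.1))
  have hcont : Continuous Φ := by
    refine continuous_pi fun ⟨i, j⟩ => ?_
    cases j with
    | none => exact continuous_finsetSum _ fun v _ => continuous_apply (v, i)
    | some k =>
      exact (continuous_apply k).comp (g.continuous.comp (by fun_prop))
  obtain ⟨x, hx, hxΦ⟩ := exists_equalizing_point p G (by simpa using hcard) hdeg Φ hcont
    (fun g' x a => by
      have h : ∀ v, recolor g' x (v, g' + a.1) = x (v, a.1) := fun v => recolor_add_apply g' x v a.1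
      simp [Φ, shift, h])
  have hz := card_mul_mem_stdSimplex hx.1 fun i i' => hxΦ i i' none
  have huniq : ∀ v i i', x (v, i) ≠ 0 → x (v, i') ≠ 0 → i = i' := fun v i i' h h' => by
    by_contra hne
    exact hx.2 _ _ h h' (Or.inl ⟨rfl, hne⟩)
  obtain ⟨c, hc, hcG⟩ := exists_coloring_extension (F := F) G
    (fun v => by have := hdeg v; omega) {v | ∃ i, x (v, i) ≠ 0}
    (fun v => Classical.epsilon fun i => x (v, i) ≠ 0)
    (fun u hu w hw huw h => hx.2 _ _ (Classical.epsilon_spec hu) (Classical.epsilon_spec hw)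
      (Or.inr ⟨huw, h⟩))
  refine ⟨c, hcG, f ⟨_, hz 0⟩, fun i => ⟨⟨_, hz i⟩, fun v hv => ?_, ?_⟩⟩
  · by_contra h
    have hvi : x (v, i) ≠ 0 := right_ne_zero_of_mul h
    refine hv ((hc v ⟨i, hvi⟩).trans (huniq v _ _ ?_ hvi))
    exact Classical.epsilon_spec (p := fun i => x (v, i) ≠ 0) ⟨i, hvi⟩
  · ext k
    have := hxΦ i 0 (some k)
    rw [← hgf, ← hgf]
    exact this

end OrderedChain

/-- Let `q ≥ 2` be a prime power, `d ≥ 1`, and `G` a graph on `(d+1)(q-1)+1` vertices with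
`q > |N²(v)| + 2|N(v)|` for every vertex `v`, where `N²(v)` is the set of vertices at
distance exactly two from `v`.  Then for every continuous `f` from the geometric simplex on
the vertex set of `G` to `ℝ^d` there is a proper `q`-coloring of `G` whose monochromatic
faces have images under `f` with a common point. -/
theorem tverberg_of_degree_bound {V : Type*} [Fintype V] [DecidableEq V]
    (G : SimpleGraph V) [DecidableRel G.Adj] (q d : ℕ)
    (hq2 : 2 ≤ q) (hq : IsPrimePow q) (hd : 1 ≤ d)
    (hcard : Fintype.card V = (d + 1) * (q - 1) + 1)
    (hdeg : ∀ v : V, ({u : V | G.dist v u = 2} : Set V).ncard + 2 * G.degree v < q)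
    (f : stdSimplex ℝ V → EuclideanSpace ℝ (Fin d)) (hf : Continuous f) :
    ∃ C : Fin q → Finset V,
      (∀ v : V, ∃! i : Fin q, v ∈ C i) ∧
      (∀ i : Fin q, ∀ u ∈ C i, ∀ w ∈ C i, ¬ G.Adj u w) ∧
      (⋂ i : Fin q, f '' {x : stdSimplex ℝ V | ∀ v ∉ C i, (x : V → ℝ) v = 0}).Nonempty := by
  obtain ⟨p, k, hp, hk, rfl⟩ := (isPrimePow_nat_iff q).1 hq
  have : Fact p.Prime := ⟨hp⟩
  let _ : Fintype (GaloisField p k) := Fintype.ofFinite _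
  have hF : Fintype.card (GaloisField p k) = p ^ k := by
    rw [← Nat.card_eq_fintype_card, GaloisField.card p k hk.ne']
  obtain ⟨c, hc, y, hy⟩ := OrderedChain.exists_coloring_of_continuous (F := GaloisField p k) p G d
    (by rwa [hF]) (by rwa [hF]) f hf
  let e : GaloisField p k ≃ Fin (p ^ k) := Fintype.equivFinOfCardEq hF
  refine ⟨fun i => Finset.univ.filter fun v => e (c v) = i, fun v => ⟨e (c v), by simp, ?_⟩, ?_,
    y, Set.mem_iInter.2 fun i => ?_⟩
  · intro i hi
    exact (Finset.mem_filter.1 hi).2.symm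
  · intro i u hu w hw huw
    exact hc u w huw
      (e.injective ((Finset.mem_filter.1 hu).2.trans (Finset.mem_filter.1 hw).2.symm))
  · obtain ⟨z, hz, hzy⟩ := hy (e.symm i)
    refine ⟨z, fun v hv => hz v fun h => hv ?_, hzy⟩
    simp [h]
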